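/- Carleman estimate with explicit constants in the case b ≡ 0 and c ≡ 0. Let ρ > 0, μ > 33·d·ρ·θ_E^{11/2}·θ_L, and set C_μ := μ − 33·d·θ_E^{11/2}·θ_L·ρ (> 0). Let C̃ := 2d²·θ_E⁸·e^{4μ√θ_E}·μ₁⁴·(3μ² + (9ρθ_L + 3)μ + 1)·C_μ^{-1} and α̃₀ := 11d⁴·θ_E^{33/2}·e^{6μ√θ_E}·μ₁⁶·(3ρθ_L + μ + 1)²·(1 + μ(μ+1)·C_μ^{-1}). Then for all α ≥ α̃₀ and all u ∈ C_c^∞(B(0,ρ) \ {0}) one has ∫_{ℝ^d} ( α ρ² w_{ρ,μ}^{1−2α} ∇uᵀA∇ū + α³ w_{ρ,μ}^{−1−2α} |u|² ) dx ≤ C̃ ρ⁴ ∫_{ℝ^d} w_{ρ,μ}^{2−2α} |div(A∇u)|² dx. -/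

import Mathlib

open MeasureTheory Real Set
open scoped ENNReal

noncomputable section

abbrev EucSp (d : ℕ) := EuclideanSpace ℝ (Fin d)

/-- Row-sum norm of a real matrix. -/
def rowSumNorm {d : ℕ} (M : Matrix (Fin d) (Fin d) ℝ) : ℝ := ⨆ i, ∑ j, |M i j|

/-- `i`-th partial derivative of a function `f : ℝ^d → ℂ`. -/
def pd {d : ℕ} (i : Fin d) (f : EucSp d → ℂ) (x : EucSp d) : ℂ :=
  fderiv ℝ f x (EuclideanSpace.single i 1)

/-- The divergence form second order operator `Hψ = -div(A∇ψ) + bᵀ∇ψ + cψ`. -/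
def Hop {d : ℕ} (A : EucSp d → Matrix (Fin d) (Fin d) ℝ)
    (b : EucSp d → Fin d → ℂ) (c : EucSp d → ℂ) (ψ : EucSp d → ℂ) (x : EucSp d) : ℂ :=
  - ∑ i, pd i (fun y => ∑ j, (A y i j : ℂ) * pd j ψ y) x
    + ∑ i, b x i * pd i ψ x + c x * ψ x

/-- Euclidean norm of a vector in ℂ^d. -/
def eucNormC {d : ℕ} (v : Fin d → ℂ) : ℝ := Real.sqrt (∑ i, ‖v i‖ ^ 2)

/-- Open centered cube `Λ_G(x₀)` of side length `G`. -/
def cube {d : ℕ} (G : ℝ) (x₀ : EucSp d) : Set (EucSp d) := {x | ∀ i, |x i - x₀ i| < G / 2}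

/-- The lattice point `G·k ∈ ℝ^d` for `k ∈ ℤ^d`. -/
def gridPt {d : ℕ} (G : ℝ) (k : Fin d → ℤ) : EucSp d :=
  (WithLp.equiv 2 (Fin d → ℝ)).symm fun i => G * (k i : ℝ)

/-- `(G,δ)`-equidistributed sequence. -/
def Equidistributed {d : ℕ} (G δ : ℝ) (z : (Fin d → ℤ) → EucSp d) : Prop :=
  ∀ k, Metric.ball (z k) δ ⊆ cube G (gridPt G k)

/-- `S_{δ,Z}`, the union of the `δ`-balls around the points of the sequence. -/
def sdz {d : ℕ} (δ : ℝ) (z : (Fin d → ℤ) → EucSp d) : Set (EucSp d) :=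
  ⋃ k, Metric.ball (z k) δ

/-- Squared `L²` norm over a set. -/
def l2sq {d : ℕ} (f : EucSp d → ℂ) (Γ : Set (EucSp d)) : ℝ :=
  ∫ x in Γ, ‖f x‖ ^ 2

/-- Essential supremum norm over a set. -/
def supNormOn {d : ℕ} {F : Type*} [NormedAddCommGroup F] (f : EucSp d → F)
    (Γ : Set (EucSp d)) : ℝ :=
  (eLpNorm f ⊤ ((volume : Measure (EucSp d)).restrict Γ)).toReal

/-- Pointwise symmetry of the coefficient matrix on a set. -/
def IsSymmA {d : ℕ} (A : EucSp d → Matrix (Fin d) (Fin d) ℝ) (Ω : Set (EucSp d)) : Prop :=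
  ∀ x ∈ Ω, ∀ i j, A x i j = A x j i

/-- Uniform ellipticity `θ_E⁻¹|ξ|² ≤ ξᵀA(x)ξ ≤ θ_E|ξ|²` on a set. -/
def IsElliptic {d : ℕ} (θE : ℝ) (A : EucSp d → Matrix (Fin d) (Fin d) ℝ)
    (Ω : Set (EucSp d)) : Prop :=
  ∀ x ∈ Ω, ∀ ξ : Fin d → ℝ,
    θE⁻¹ * (∑ i, ξ i ^ 2) ≤ (∑ i, ∑ j, ξ i * A x i j * ξ j) ∧
      (∑ i, ∑ j, ξ i * A x i j * ξ j) ≤ θE * (∑ i, ξ i ^ 2)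

/-- Lipschitz condition in the row-sum norm on a set. -/
def IsLipA {d : ℕ} (θL : ℝ) (A : EucSp d → Matrix (Fin d) (Fin d) ℝ)
    (Ω : Set (EucSp d)) : Prop :=
  ∀ x ∈ Ω, ∀ y ∈ Ω, rowSumNorm (A x - A y) ≤ θL * ‖x - y‖

/-- The annulus `B(x,R) \ closure(B(x,r))`. -/
def annulus {d : ℕ} (x : EucSp d) (r R : ℝ) : Set (EucSp d) :=
  Metric.ball x R \ Metric.closedBall x r

/-- `μ = 33·d·R₃·θ_E^{11/2}·θ_L + ε`. -/
def muOf (d : ℕ) (θE θL R₃ ε : ℝ) : ℝ := 33 * d * R₃ * θE ^ ((11:ℝ)/2) * θL + ε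

/-- `μ₁`, defined from `μ` and `θ_E`. -/
def mu1Of (θE μ : ℝ) : ℝ :=
  if μ * Real.sqrt θE ≤ 1 then Real.exp (μ * Real.sqrt θE) else Real.exp 1 * (μ * Real.sqrt θE)

/-- The quadratic gradient form `∇uᵀA∇ū = ∑_{ij} a^{ij} ∂_i u ∂_j ū` (a real number). -/
def gradForm {d : ℕ} (A : EucSp d → Matrix (Fin d) (Fin d) ℝ) (u : EucSp d → ℂ)
    (x : EucSp d) : ℝ :=
  (∑ i, ∑ j, (A x i j : ℂ) * pd i u x * (starRingEnd ℂ) (pd j u x)).re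

/-- `σ(x) = (xᵀA(0)⁻¹x)^{1/2}`. -/
def sigmaA {d : ℕ} (A : EucSp d → Matrix (Fin d) (Fin d) ℝ) (x : EucSp d) : ℝ :=
  Real.sqrt (∑ i, ∑ j, x i * (A 0)⁻¹ i j * x j)

/-- `φ(r) = r·exp(−∫₀^r (1−e^{−μt})/t dt)`. -/
def phiW (μ r : ℝ) : ℝ :=
  r * Real.exp (-(∫ t in (0:ℝ)..r, (1 - Real.exp (-(μ * t))) / t))

/-- The Carleman weight `w_{ρ,μ}(x) = φ(σ(x/ρ))`. -/
def wWeight {d : ℕ} (A : EucSp d → Matrix (Fin d) (Fin d) ℝ) (ρ μ : ℝ) (x : EucSp d) : ℝ :=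
  phiW μ (sigmaA A (ρ⁻¹ • x))


/-- The divergence `div(A∇u)`. -/
def divAgrad {d : ℕ} (A : EucSp d → Matrix (Fin d) (Fin d) ℝ) (u : EucSp d → ℂ)
    (x : EucSp d) : ℂ :=
  ∑ i, pd i (fun y => ∑ j, (A y i j : ℂ) * pd j u y) x


theorem scal_grad {n L s m Cm σ a G0 τ1 τ2 bp e2 e3 κ : ℝ} (hn : 1 ≤ n) (hL : 0 ≤ L) (hs : 1 ≤ s)
    (hm : m = Cm + 33 * n * L * s ^ 11) (hCm : 0 < Cm) (hσ : 0 < σ) (ha : 0 ≤ a)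
    (hκ : κ * s ^ 4 = 1)
    (hG : κ * σ ^ 2 ≤ G0)
    (h1 : |τ1| ≤ n * L * s * σ) (h2 : |τ2 - n| ≤ n * L * s ^ 3 * σ)
    (hbp : |bp - a| ≤ L * s ^ 5 * σ * a) (h3 : |e3| ≤ L * s ^ 3 * σ * a)
    (he2 : |e2| ≤ L * s ^ 5 * σ * a) :
    a * (σ * κ * Cm) ≤ a * (m * G0 / σ + (τ1 + τ2) - 2 - (n - 2)) - 2 * (bp - a) - 2 * e3 + e2 := by
  have hs0 : 0 < s := by linarith
  have hκ0 : 0 < κ := by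
    have : 0 < s ^ 4 := by positivity
    by_contra h
    push Not at h
    nlinarith
  have hm0 : 0 < m := by rw [hm]; positivity
  have k1 : m * (κ * σ) ≤ m * G0 / σ := by
    rw [le_div_iff₀ hσ]
    nlinarith [mul_le_mul_of_nonneg_left hG hm0.le]
  have k2 : m * (κ * σ) = σ * κ * Cm + 33 * (n * L * s ^ 7 * σ) := by
    rw [hm]; linear_combination (33 * n * L * s ^ 7 * σ) * hκ
  have hns : ∀ j : ℕ, j ≤ 7 → n * L * s ^ j * σ ≤ n * L * s ^ 7 * σ := by
    intro j hj
    have := pow_le_pow_right₀ hs hj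
    gcongr
  have hls : ∀ j : ℕ, j ≤ 7 → L * s ^ j * σ ≤ n * L * s ^ 7 * σ := by
    intro j hj
    have h := pow_le_pow_right₀ hs hj
    have : L * s ^ j ≤ n * L * s ^ 7 := by
      calc L * s ^ j = 1 * L * s ^ j := by ring
        _ ≤ _ := by gcongr
    gcongr
  have q1 := hns 1 (by norm_num)
  have q3 := hns 3 (by norm_num)
  have l3 := hls 3 (by norm_num)
  have l5 := hls 5 (by norm_num)
  rw [pow_one] at q1
  rw [abs_le] at *
  have := mul_le_mul_of_nonneg_left (show σ * κ * Cm + 31 * (n * L * s ^ 7 * σ) ≤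
    m * G0 / σ + (τ1 + τ2) - 2 - (n - 2) by linarith [h1.1, h2.1]) ha
  have u3 := mul_le_mul_of_nonneg_right l3 ha
  have u5 := mul_le_mul_of_nonneg_right l5 ha
  have : 0 ≤ n * L * s ^ 7 * σ * a := by positivity
  nlinarith [hbp.2, h3.2, he2.1]

theorem scal_f {n L s m Cm σ G0 τ1 τ2 ζ e5 κ : ℝ} (hn : 1 ≤ n) (hL : 0 ≤ L) (hs : 1 ≤ s)
    (hm : m = Cm + 33 * n * L * s ^ 11) (hCm : 0 < Cm) (hσ : 0 < σ)
    (hκ : κ * s ^ 4 = 1)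
    (hG : κ * σ ^ 2 ≤ G0)
    (h1 : |τ1| ≤ n * L * s * σ) (h2 : |τ2 - n| ≤ n * L * s ^ 3 * σ)
    (hG1 : |G0 - σ ^ 2| ≤ L * s ^ 3 * σ ^ 3)
    (hζ : |ζ - G0| ≤ L * s ^ 5 * σ * G0) (h5 : |e5| ≤ L * s ^ 3 * σ * G0) :
    σ ^ 3 * κ ^ 2 * Cm ≤
      (m / σ + 4 / σ ^ 2) * G0 ^ 2 - 2 * ζ - e5 + G0 * (n - 2 - (τ1 + τ2)) := by
  have hs0 : 0 < s := by linarith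
  have hκ0 : 0 < κ := by
    have : 0 < s ^ 4 := by positivity
    by_contra h
    push Not at h
    nlinarith
  have hm0 : 0 < m := by rw [hm]; positivity
  have hG0 : 0 < G0 := lt_of_lt_of_le (by positivity) hG
  have k1 : m * (κ * σ) ≤ m * G0 / σ := by
    rw [le_div_iff₀ hσ]
    nlinarith [mul_le_mul_of_nonneg_left hG hm0.le]
  have k2 : m * (κ * σ) = σ * κ * Cm + 33 * (n * L * s ^ 7 * σ) := by
    rw [hm]; linear_combination (33 * n * L * s ^ 7 * σ) * hκ
  have hns : ∀ j : ℕ, j ≤ 7 → n * L * s ^ j * σ ≤ n * L * s ^ 7 * σ := by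
    intro j hj
    have := pow_le_pow_right₀ hs hj
    gcongr
  have hls : ∀ j : ℕ, j ≤ 7 → L * s ^ j * σ ≤ n * L * s ^ 7 * σ := by
    intro j hj
    have h := pow_le_pow_right₀ hs hj
    have : L * s ^ j ≤ n * L * s ^ 7 := by
      calc L * s ^ j = 1 * L * s ^ j := by ring
        _ ≤ _ := by gcongr
    gcongr
  have q1 := hns 1 (by norm_num)
  have q3 := hns 3 (by norm_num)
  have l3 := hls 3 (by norm_num)
  have l5 := hls 5 (by norm_num)
  rw [pow_one] at q1
  have g1 : 1 - L * s ^ 3 * σ ≤ G0 / σ ^ 2 := by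
    rw [le_div_iff₀ (by positivity)]
    rw [abs_le] at hG1
    nlinarith [hG1.1]
  rw [abs_le] at *
  have u3 := mul_le_mul_of_nonneg_right l3 hG0.le
  have u5 := mul_le_mul_of_nonneg_right l5 hG0.le
  have p7 : 0 ≤ n * L * s ^ 7 * σ * G0 := by positivity
  have main := mul_le_mul_of_nonneg_left (show σ * κ * Cm + 27 * (n * L * s ^ 7 * σ) + 2 ≤
    m * G0 / σ + 4 * (G0 / σ ^ 2) + (n - 2 - (τ1 + τ2))
      by linarith [h1.2, h2.2]) hG0.le
  have e : (m / σ + 4 / σ ^ 2) * G0 ^ 2 + G0 * (n - 2 - (τ1 + τ2)) =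
      G0 * (m * G0 / σ + 4 * (G0 / σ ^ 2) + (n - 2 - (τ1 + τ2))) := by
    field_simp
  have fin : σ ^ 3 * κ ^ 2 * Cm ≤ G0 * (σ * κ * Cm) := by
    have := mul_le_mul_of_nonneg_right hG (show 0 ≤ σ * κ * Cm by positivity)
    nlinarith
  nlinarith [hζ.2, h5.2]

theorem scal_R {n L s m Cm σ G0 τ1 τ2 : ℝ} (hn : 1 ≤ n) (hL : 0 ≤ L) (hs : 1 ≤ s)
    (hm : m = Cm + 33 * n * L * s ^ 11) (hCm : 0 < Cm) (hσ : 0 < σ)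
    (hG : 0 ≤ G0) (hGu : G0 ≤ s ^ 4 * σ ^ 2)
    (h1 : |τ1| ≤ n * L * s * σ) (h2 : |τ2 - n| ≤ n * L * s ^ 3 * σ)
    (hG1 : |G0 - σ ^ 2| ≤ L * s ^ 3 * σ ^ 3) :
    (τ1 + τ2 - G0 * (m / σ + 2 / σ ^ 2) - (n - 2)) ^ 2 ≤ (1.26 * m ^ 2 * s ^ 8) * σ ^ 2 := by
  have hs0 : 0 < s := by linarith
  have hm0 : 0 < m := by rw [hm]; positivity
  have g1 : |G0 / σ ^ 2 - 1| ≤ L * s ^ 3 * σ := by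
    have : G0 / σ ^ 2 - 1 = (G0 - σ ^ 2) / σ ^ 2 := by field_simp
    rw [this, abs_div, abs_of_pos (show 0 < σ ^ 2 by positivity), div_le_iff₀ (by positivity)]
    nlinarith
  have g2 : |m * G0 / σ| ≤ m * s ^ 4 * σ := by
    rw [abs_of_nonneg (by positivity), div_le_iff₀ hσ]
    nlinarith [mul_le_mul_of_nonneg_left hGu hm0.le]
  have hns : ∀ j : ℕ, j ≤ 15 → n * L * s ^ j * σ ≤ n * L * s ^ 15 * σ := by
    intro j hj
    have := pow_le_pow_right₀ hs hj
    gcongr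
  have hls : L * s ^ 3 * σ ≤ n * L * s ^ 15 * σ := by
    have h := pow_le_pow_right₀ hs (show 3 ≤ 15 by norm_num)
    have : L * s ^ 3 ≤ n * L * s ^ 15 := by
      calc L * s ^ 3 = 1 * L * s ^ 3 := by ring
        _ ≤ _ := by gcongr
    gcongr
  have q1 := hns 1 (by norm_num)
  have q3 := hns 3 (by norm_num)
  rw [pow_one] at q1
  have e : n * L * s ^ 15 * σ ≤ m * s ^ 4 * σ / 33 := by
    have : 0 ≤ Cm * s ^ 4 * σ := by positivity
    rw [hm]; nlinarith
  have e2 : τ1 + τ2 - G0 * (m / σ + 2 / σ ^ 2) - (n - 2) =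
     τ1 + (τ2 - n) - m * G0 / σ - 2 * (G0 / σ ^ 2 - 1) := by
    field_simp; ring
  rw [e2]
  have : |τ1 + (τ2 - n) - m * G0 / σ - 2 * (G0 / σ ^ 2 - 1)| ≤ 37 / 33 * (m * s ^ 4 * σ) := by
    rw [abs_le] at *
    constructor <;> linarith [h1.1, h1.2, h2.1, h2.2, g1.1, g1.2, g2.1, g2.2]
  calc _ = |τ1 + (τ2 - n) - m * G0 / σ - 2 * (G0 / σ ^ 2 - 1)| ^ 2 := (sq_abs _).symm
    _ ≤ (37 / 33 * (m * s ^ 4 * σ)) ^ 2 := by gcongr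
    _ = (37 / 33) ^ 2 * (m * s ^ 4 * σ) ^ 2 := by ring
    _ ≤ 1.26 * (m * s ^ 4 * σ) ^ 2 := by gcongr; norm_num
    _ = _ := by ring

theorem scal_C1 (x t : ℝ) : t ^ 2 - x * t ≤ 1.5 * t ^ 2 + x ^ 2 / 2 := by
  linarith [sq_nonneg (x + t)]

theorem scal_Y (P R : ℝ) : (P - R) ^ 2 ≤ 1.1 * P ^ 2 + 11 * R ^ 2 := by
  linarith [sq_nonneg (P + 10 * R)]

theorem scal_C4 {κ s m n α F σ f Cm : ℝ} (hF : 0 < F) (hσ : 0 < σ) (hκ8 : κ ^ 2 * s ^ 8 = 1) :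
    0.05 * (2 * α ^ 3 * κ ^ 2 * Cm * (F / σ) * f ^ 2)
      - 4 * α * m * (F / σ) * (((n - 2) / 2 / F) ^ 2 * f ^ 2 / 2) =
    (0.1 * α * κ ^ 2 * f ^ 2 / (σ * F)) * (α ^ 2 * Cm * F ^ 2 - 5 * m * (n - 2) ^ 2 * s ^ 8) := by
  have : 4 * α * m * (F / σ) * (((n - 2) / 2 / F) ^ 2 * f ^ 2 / 2) =
    4 * α * m * (F / σ) * (((n - 2) / 2 / F) ^ 2 * f ^ 2 / 2) * (κ ^ 2 * s ^ 8) := by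
    rw [hκ8, mul_one]
  rw [this]
  field_simp
  ring

theorem scal_C5 {κ s m α F σ f Cm : ℝ} (hσ : 0 < σ) (hκ8 : κ ^ 2 * s ^ 8 = 1) :
    0.05 * (2 * α ^ 3 * κ ^ 2 * Cm * (F / σ) * f ^ 2) - 13.9 * α ^ 2 * f ^ 2 * m ^ 2 * s ^ 8 =
        (0.1 * α ^ 2 * κ ^ 2 * f ^ 2 / σ) * (α * Cm * F - 139 * m ^ 2 * s ^ 16 * σ) := by
  have : 13.9 * α ^ 2 * f ^ 2 * m ^ 2 * s ^ 8 =
    13.9 * α ^ 2 * f ^ 2 * m ^ 2 * s ^ 8 * (κ ^ 2 * s ^ 8) := by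
    rw [hκ8, mul_one]
  rw [this]
  field_simp
  ring

theorem scal_id {n m σ a G0 τ1 τ2 bp e2 e3 ζ e5 F α f Lf t : ℝ} (hF : 0 < F) (hσ : 0 < σ) :
    4 * α * (Lf + α ^ 2 * (F ^ 2 / σ ^ 4) * G0 * f) * t =
    4 * α * (F⁻¹ * ((m / σ) * ((F * t - (n - 2) / 2 * f) ^ 2 - a * G0 / 2
        + (n - 2) / 2 * f * (F * t - (n - 2) / 2 * f))
        + (F * t - (n - 2) / 2 * f) * Lf + e3 + bp
        - a * (τ1 + τ2) / 2 - e2 / 2 + (n - 2) / 2 * a + (n - 2) / 2 * f * Lf)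
      + α ^ 2 / 2 * (F / σ ^ 4) * (-(m / σ + 4 / σ ^ 2) * G0 ^ 2 * f ^ 2 + f ^ 2 * (e5 + 2 * ζ)
        + 2 * G0 * f * (F * t - (n - 2) / 2 * f) + G0 * f ^ 2 * (τ1 + τ2))) +
      (2 * α / F) * (a * (m * G0 / σ + (τ1 + τ2) - 2 - (n - 2)) - 2 * (bp - a) - 2 * e3 + e2)
      - 4 * α * m * (F / σ) * (t ^ 2 - ((n - 2) / 2 / F) * f * t)
      + 2 * α ^ 3 * (F / σ ^ 4) * f ^ 2 * ((m / σ + 4 / σ ^ 2) * G0 ^ 2 - 2 * ζ - e5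
          + G0 * (n - 2 - (τ1 + τ2))) := by
  field_simp; ring

set_option maxHeartbeats 1000000 in
theorem scal_main {n L s m Cm σ a G0 τ1 τ2 bp e2 e3 ζ e5 κ F α f Lf b0 dV P : ℝ}
    (hn : 1 ≤ n) (hL : 0 ≤ L) (hs : 1 ≤ s)
    (hm : m = Cm + 33 * n * L * s ^ 11) (hCm : 0 < Cm) (hσ : 0 < σ) (ha : 0 ≤ a)
    (hF : 0 < F) (hα : 0 < α)
    (hκ : κ * s ^ 4 = 1)
    (hG : κ * σ ^ 2 ≤ G0) (hGu : G0 ≤ s ^ 4 * σ ^ 2)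
    (h1 : |τ1| ≤ n * L * s * σ) (h2 : |τ2 - n| ≤ n * L * s ^ 3 * σ)
    (hG1 : |G0 - σ ^ 2| ≤ L * s ^ 3 * σ ^ 3)
    (hbp : |bp - a| ≤ L * s ^ 5 * σ * a) (h3 : |e3| ≤ L * s ^ 3 * σ * a)
    (he2 : |e2| ≤ L * s ^ 5 * σ * a)
    (hζ : |ζ - G0| ≤ L * s ^ 5 * σ * G0) (h5 : |e5| ≤ L * s ^ 3 * σ * G0)
    (hα1 : 1.5 * m * σ ≤ α * F)
    (hα2 : 139 * m ^ 2 * s ^ 16 * σ ≤ α * Cm * F)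
    (hα3 : 5 * m * (n - 2) ^ 2 * s ^ 8 ≤ α ^ 2 * Cm * F ^ 2)
    (hdV : dV = F⁻¹ * ((m / σ) * (b0 ^ 2 - a * G0 / 2 + (n - 2) / 2 * f * b0) + b0 * Lf + e3 + bp
        - a * (τ1 + τ2) / 2 - e2 / 2 + (n - 2) / 2 * a + (n - 2) / 2 * f * Lf)
      + α ^ 2 / 2 * (F / σ ^ 4) * (-(m / σ + 4 / σ ^ 2) * G0 ^ 2 * f ^ 2 + f ^ 2 * (e5 + 2 * ζ)
        + 2 * G0 * f * b0 + G0 * f ^ 2 * (τ1 + τ2)))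
    (hP : P = Lf + α ^ 2 * (F ^ 2 / σ ^ 4) * G0 * f + 2 * α * (F / σ ^ 2) * b0
      + α * f * (F / σ ^ 2) * (τ1 + τ2 - G0 * (m / σ + 2 / σ ^ 2))) :
    0.9 * (2 * α * κ * Cm * (σ / F) * a + 2 * α ^ 3 * κ ^ 2 * Cm * (F / σ) * f ^ 2) + 4 * α * dV ≤
      1.1 * (σ ^ 2 / F ^ 2) * P ^ 2 := by
  have hm0 : 0 < m := by rw [hm]; positivity
  have hs0 : 0 < s := by linarith
  have hκ0 : 0 < κ := by
    have : 0 < s ^ 4 := by positivity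
    by_contra h
    push Not at h
    nlinarith
  have A1 := scal_grad hn hL hs hm hCm hσ ha hκ hG h1 h2 hbp h3 he2
  have A2 := scal_f hn hL hs hm hCm hσ hκ hG h1 h2 hG1 hζ h5
  have hG0 : 0 < G0 := lt_of_lt_of_le (by positivity) hG
  have A3 := scal_R hn hL hs hm hCm hσ hG0.le hGu h1 h2 hG1
  set Λ := τ1 + τ2 - G0 * (m / σ + 2 / σ ^ 2) - (n - 2) with hΛ
  set R := α * f * (F / σ ^ 2) * Λ with hR
  set S := Lf + α ^ 2 * (F ^ 2 / σ ^ 4) * G0 * f with hS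
  set t := (b0 + (n - 2) / 2 * f) / F with ht
  have hb0 : b0 = F * t - (n - 2) / 2 * f := by rw [ht]; field_simp; ring
  have hPR : P - R = S + 2 * α * (F ^ 2 / σ ^ 2) * t := by
    rw [hP, hR, hΛ, hS, hb0]; field_simp; ring
  have sq : 4 * α * S * t + 4 * α ^ 2 * (F ^ 2 / σ ^ 2) * t ^ 2 ≤ (σ ^ 2 / F ^ 2) * (P - R) ^ 2 := by
    rw [hPR]
    have : (σ ^ 2 / F ^ 2) * (S + 2 * α * (F ^ 2 / σ ^ 2) * t) ^ 2 =
      (σ ^ 2 / F ^ 2) * S ^ 2 + (4 * α * S * t + 4 * α ^ 2 * (F ^ 2 / σ ^ 2) * t ^ 2) := by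
      field_simp; ring
    rw [this]
    have : 0 ≤ (σ ^ 2 / F ^ 2) * S ^ 2 := by positivity
    linarith
  have id1 : 4 * α * S * t = 4 * α * dV +
      (2 * α / F) * (a * (m * G0 / σ + (τ1 + τ2) - 2 - (n - 2)) - 2 * (bp - a) - 2 * e3 + e2)
      - 4 * α * m * (F / σ) * (t ^ 2 - ((n - 2) / 2 / F) * f * t)
      + 2 * α ^ 3 * (F / σ ^ 4) * f ^ 2 * ((m / σ + 4 / σ ^ 2) * G0 ^ 2 - 2 * ζ - e5
          + G0 * (n - 2 - (τ1 + τ2))) := by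
    rw [hdV, hS, hb0]; exact scal_id hF hσ
  have B1 := mul_le_mul_of_nonneg_left A1 (show 0 ≤ 2 * α / F by positivity)
  have B2 := mul_le_mul_of_nonneg_left A2 (show 0 ≤ 2 * α ^ 3 * (F / σ ^ 4) * f ^ 2 by positivity)
  have B1' : (2 * α / F) * (a * (σ * κ * Cm)) = 2 * α * κ * Cm * (σ / F) * a := by field_simp
  have B2' : 2 * α ^ 3 * (F / σ ^ 4) * f ^ 2 * (σ ^ 3 * κ ^ 2 * Cm) =
      2 * α ^ 3 * κ ^ 2 * Cm * (F / σ) * f ^ 2 := by field_simp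
  rw [B1'] at B1
  rw [B2'] at B2
  set X1 := 2 * α * κ * Cm * (σ / F) * a with hX1
  set X2 := 2 * α ^ 3 * κ ^ 2 * Cm * (F / σ) * f ^ 2 with hX2
  -- the cross term
  have C1 : t ^ 2 - ((n - 2) / 2 / F) * f * t ≤ 1.5 * t ^ 2 + ((n - 2) / 2 / F) ^ 2 * f ^ 2 / 2 := by
    have := scal_C1 (((n - 2) / 2 / F) * f) t
    rw [← mul_pow]; exact this
  have C2 := mul_le_mul_of_nonneg_left C1 (show 0 ≤ 4 * α * m * (F / σ) by positivity)
  have C3 : 4 * α * m * (F / σ) * (1.5 * t ^ 2) ≤ 4 * α ^ 2 * (F ^ 2 / σ ^ 2) * t ^ 2 := by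
    have e : 4 * α ^ 2 * (F ^ 2 / σ ^ 2) * t ^ 2 - 4 * α * m * (F / σ) * (1.5 * t ^ 2) =
        (4 * α * (F / σ ^ 2) * t ^ 2) * (α * F - 1.5 * m * σ) := by field_simp
    have : 0 ≤ (4 * α * (F / σ ^ 2) * t ^ 2) * (α * F - 1.5 * m * σ) :=
      mul_nonneg (by positivity) (by linarith)
    linarith
  have hκ8 : κ ^ 2 * s ^ 8 = 1 := by
    calc κ ^ 2 * s ^ 8 = (κ * s ^ 4) ^ 2 := by ring
      _ = 1 := by rw [hκ]; norm_num
  have C4 : 4 * α * m * (F / σ) * (((n - 2) / 2 / F) ^ 2 * f ^ 2 / 2) ≤ 0.05 * X2 := by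
    have e : 0.05 * X2 - 4 * α * m * (F / σ) * (((n - 2) / 2 / F) ^ 2 * f ^ 2 / 2) =
        (0.1 * α * κ ^ 2 * f ^ 2 / (σ * F)) * (α ^ 2 * Cm * F ^ 2 - 5 * m * (n - 2) ^ 2 * s ^ 8) := by
      rw [hX2]; exact scal_C4 hF hσ hκ8
    have : 0 ≤ (0.1 * α * κ ^ 2 * f ^ 2 / (σ * F)) *
      (α ^ 2 * Cm * F ^ 2 - 5 * m * (n - 2) ^ 2 * s ^ 8) :=
      mul_nonneg (by positivity) (by linarith)
    linarith
  have C5 : 11 * (σ ^ 2 / F ^ 2) * R ^ 2 ≤ 0.05 * X2 := by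
    have e1 : 11 * (σ ^ 2 / F ^ 2) * R ^ 2 = 11 * α ^ 2 * f ^ 2 / σ ^ 2 * Λ ^ 2 := by
      rw [hR]; field_simp
    have e2 := mul_le_mul_of_nonneg_left A3 (show 0 ≤ 11 * α ^ 2 * f ^ 2 / σ ^ 2 by positivity)
    have e3 : 11 * α ^ 2 * f ^ 2 / σ ^ 2 * (1.26 * m ^ 2 * s ^ 8 * σ ^ 2) =
      13.86 * α ^ 2 * f ^ 2 * m ^ 2 * s ^ 8 := by field_simp; ring
    have e : 0.05 * X2 - 13.9 * α ^ 2 * f ^ 2 * m ^ 2 * s ^ 8 =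
        (0.1 * α ^ 2 * κ ^ 2 * f ^ 2 / σ) * (α * Cm * F - 139 * m ^ 2 * s ^ 16 * σ) := by
      rw [hX2]; exact scal_C5 hσ hκ8
    have : 0 ≤ (0.1 * α ^ 2 * κ ^ 2 * f ^ 2 / σ) * (α * Cm * F - 139 * m ^ 2 * s ^ 16 * σ) :=
      mul_nonneg (by positivity) (by linarith)
    have : 0 ≤ α ^ 2 * f ^ 2 * m ^ 2 * s ^ 8 := by positivity
    linarith
  have Y : (P - R) ^ 2 ≤ 1.1 * P ^ 2 + 11 * R ^ 2 := scal_Y P R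
  have Y2 := mul_le_mul_of_nonneg_left Y (show 0 ≤ σ ^ 2 / F ^ 2 by positivity)
  have X1n : 0 ≤ X1 := by positivity
  linarith

/-- Pointwise final comparison. -/
theorem scal_fin {s Cm σ a G0 κ F α f b0 dV P ρ W E M1 : ℝ}
    (hs : 1 ≤ s) (hCm : 0 < Cm) (hσ : 0 < σ) (ha : 0 ≤ a)
    (hF : 0 < F) (hF1 : F ≤ 1) (hα : 0 < α) (hκ : κ * s ^ 4 = 1) (hGu : G0 ≤ s ^ 4 * σ ^ 2)
    (hρ : 0 < ρ) (hW : 0 < W) (hW1 : ρ * W ≤ σ) (hW2 : σ ≤ M1 * (ρ * W)) (hM1 : 1 ≤ M1)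
    (hE : 1 ≤ E * F) (hE1 : 1 ≤ E)
    (hcs : 2 * (α * f * (F / σ ^ 2)) * b0 ≤ a + (α * f * (F / σ ^ 2)) ^ 2 * G0)
    (hmain : 0.9 * (2 * α * κ * Cm * (σ / F) * a + 2 * α ^ 3 * κ ^ 2 * Cm * (F / σ) * f ^ 2)
      + 4 * α * dV ≤ 1.1 * (σ ^ 2 / F ^ 2) * P ^ 2) :
    α * ρ ^ 2 * W * (a + 2 * (α * f * (F / σ ^ 2)) * b0 + (α * f * (F / σ ^ 2)) ^ 2 * G0)
      + α ^ 3 * W⁻¹ * f ^ 2 ≤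
    (2 * s ^ 12 * E ^ 3 * M1 ^ 3 / (Cm * ρ)) * ρ ^ 4 * (W ^ 2 * P ^ 2)
      - (1.5 * s ^ 12 * E * M1 * ρ / Cm) * (4 * α * dV) / 0.9 := by
  have hs0 : 0 < s := by linarith
  have hκ0 : 0 < κ := by
    have : 0 < s ^ 4 := by positivity
    by_contra h
    push Not at h
    nlinarith
  have hE0 : 0 < E := by linarith
  have hM0 : 0 < M1 := by linarith
  have hκ8 : κ ^ 2 * s ^ 8 = 1 := by
    calc κ ^ 2 * s ^ 8 = (κ * s ^ 4) ^ 2 := by ring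
      _ = 1 := by rw [hκ]; norm_num
  set c := α * f * (F / σ ^ 2) with hc
  set X1 := 2 * α * κ * Cm * (σ / F) * a with hX1
  set X2 := 2 * α ^ 3 * κ ^ 2 * Cm * (F / σ) * f ^ 2 with hX2
  have l1 : α * ρ ^ 2 * W * (a + 2 * c * b0 + c ^ 2 * G0) ≤
      α * ρ * σ * (2 * a + 2 * c ^ 2 * (s ^ 4 * σ ^ 2)) := by
    have h1 : a + 2 * c * b0 + c ^ 2 * G0 ≤ 2 * a + 2 * c ^ 2 * (s ^ 4 * σ ^ 2) := by
      have := mul_le_mul_of_nonneg_left hGu (sq_nonneg c)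
      linarith
    calc _ ≤ α * ρ ^ 2 * W * (2 * a + 2 * c ^ 2 * (s ^ 4 * σ ^ 2)) := by gcongr
      _ = α * ρ * (ρ * W) * (2 * a + 2 * c ^ 2 * (s ^ 4 * σ ^ 2)) := by ring
      _ ≤ _ := by gcongr
  have l2 : α ^ 3 * W⁻¹ * f ^ 2 ≤ α ^ 3 * (M1 * ρ / σ) * f ^ 2 := by
    have : W⁻¹ ≤ M1 * ρ / σ := by
      rw [le_div_iff₀ hσ, inv_mul_le_iff₀ hW]; linarith
    gcongr
  -- a-part
  have l3 : α * ρ * σ * (2 * a) ≤ (1.5 * s ^ 12 * E * M1 * ρ / Cm) * X1 := by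
    have e : (1.5 * s ^ 12 * E * M1 * ρ / Cm) * X1 =
        (α * ρ * σ * (2 * a)) * (1.5 * (s ^ 8 * E * M1 / F)) := by
      rw [hX1]; field_simp
      linear_combination a * hκ
    rw [e]
    have : 1 ≤ s ^ 8 * E * M1 / F := by
      rw [le_div_iff₀ hF]
      have : (1:ℝ) ≤ s ^ 8 * E * M1 := by
        have h8 : 1 ≤ s ^ 8 := one_le_pow₀ hs
        calc (1:ℝ) = 1 * 1 * 1 := by norm_num
          _ ≤ _ := by gcongr
      linarith
    exact le_mul_of_one_le_right (by positivity) (by linarith)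
  have l4 : α * ρ * σ * (2 * c ^ 2 * (s ^ 4 * σ ^ 2)) + α ^ 3 * (M1 * ρ / σ) * f ^ 2 ≤
      (1.5 * s ^ 12 * E * M1 * ρ / Cm) * X2 := by
    have e1 : (1.5 * s ^ 12 * E * M1 * ρ / Cm) * X2 =
        (α ^ 3 * ρ / σ * f ^ 2) * (3 * s ^ 4 * M1 * (E * F)) := by
      rw [hX2]; field_simp
      linear_combination (3 * f ^ 2) * hκ8
    have e2 : α * ρ * σ * (2 * c ^ 2 * (s ^ 4 * σ ^ 2)) + α ^ 3 * (M1 * ρ / σ) * f ^ 2 =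
        (α ^ 3 * ρ / σ * f ^ 2) * (2 * F ^ 2 * s ^ 4 + M1) := by
      rw [hc]; field_simp
    rw [e1, e2]
    apply mul_le_mul_of_nonneg_left _ (by positivity)
    have h4 : 1 ≤ s ^ 4 := one_le_pow₀ hs
    have hF2 : F ^ 2 ≤ 1 := pow_le_one₀ hF.le hF1
    have i1 : 2 * F ^ 2 * s ^ 4 ≤ 2 * (s ^ 4 * M1) := by
      have : F ^ 2 * s ^ 4 ≤ M1 * s ^ 4 := by gcongr; linarith
      linarith
    have i2 : M1 ≤ s ^ 4 * M1 := le_mul_of_one_le_left hM0.le h4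
    have i3 : 3 * s ^ 4 * M1 ≤ 3 * s ^ 4 * M1 * (E * F) := le_mul_of_one_le_right (by positivity) hE
    linarith
  have l5 : 1.1 * (σ ^ 2 / F ^ 2) * P ^ 2 ≤ 1.1 * (E ^ 2 * M1 ^ 2 * ρ ^ 2 * (W ^ 2 * P ^ 2)) := by
    have : σ ^ 2 / F ^ 2 ≤ E ^ 2 * M1 ^ 2 * ρ ^ 2 * W ^ 2 := by
      rw [div_le_iff₀ (by positivity)]
      calc σ ^ 2 ≤ (M1 * (ρ * W)) ^ 2 := by gcongr
        _ ≤ (M1 * (ρ * W)) ^ 2 * (E * F) ^ 2 :=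
          le_mul_of_one_le_right (by positivity) (one_le_pow₀ hE)
        _ = _ := by ring
    have := mul_le_mul_of_nonneg_right this (sq_nonneg P)
    linarith
  have l6 := mul_le_mul_of_nonneg_left (hmain.trans l5)
    (show 0 ≤ (1.5 * s ^ 12 * E * M1 * ρ / Cm) / 0.9 by positivity)
  have l7 : (1.5 * s ^ 12 * E * M1 * ρ / Cm) / 0.9 *
      (1.1 * (E ^ 2 * M1 ^ 2 * ρ ^ 2 * (W ^ 2 * P ^ 2))) ≤
      (2 * s ^ 12 * E ^ 3 * M1 ^ 3 / (Cm * ρ)) * ρ ^ 4 * (W ^ 2 * P ^ 2) := by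
    have e : (2 * s ^ 12 * E ^ 3 * M1 ^ 3 / (Cm * ρ)) * ρ ^ 4 * (W ^ 2 * P ^ 2) =
      2 * ((s ^ 12 * E ^ 3 * M1 ^ 3 / Cm) * ρ ^ 3 * (W ^ 2 * P ^ 2)) := by field_simp
    have e' : (1.5 * s ^ 12 * E * M1 * ρ / Cm) / 0.9 *
      (1.1 * (E ^ 2 * M1 ^ 2 * ρ ^ 2 * (W ^ 2 * P ^ 2))) =
      1.65 / 0.9 * ((s ^ 12 * E ^ 3 * M1 ^ 3 / Cm) * ρ ^ 3 * (W ^ 2 * P ^ 2)) := by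
      field_simp; ring
    rw [e, e']
    have : 0 ≤ (s ^ 12 * E ^ 3 * M1 ^ 3 / Cm) * ρ ^ 3 * (W ^ 2 * P ^ 2) := by positivity
    apply mul_le_mul_of_nonneg_right _ this
    norm_num
  have l8 : (1.5 * s ^ 12 * E * M1 * ρ / Cm) / 0.9 * (0.9 * (X1 + X2) + 4 * α * dV) =
      (1.5 * s ^ 12 * E * M1 * ρ / Cm) * X1 + (1.5 * s ^ 12 * E * M1 * ρ / Cm) * X2 +
      (1.5 * s ^ 12 * E * M1 * ρ / Cm) * (4 * α * dV) / 0.9 := by ring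
  rw [l8] at l6
  linarith

theorem one_sub_exp_bounds {μ t : ℝ} (hμ : 0 < μ) (ht : 0 < t) :
    0 ≤ (1 - Real.exp (-(μ * t))) / t ∧ (1 - Real.exp (-(μ * t))) / t ≤ μ ∧
    (1 - Real.exp (-(μ * t))) / t ≤ 1 / t := by
  have h1 : Real.exp (-(μ * t)) ≤ 1 := by
    rw [Real.exp_le_one_iff]; have := mul_pos hμ ht; linarith
  have h2 : -(μ * t) + 1 ≤ Real.exp (-(μ * t)) := Real.add_one_le_exp _
  have h3 := Real.exp_pos (-(μ * t))
  refine ⟨div_nonneg (by linarith) ht.le, ?_, ?_⟩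
  · rw [div_le_iff₀ ht]; linarith
  · gcongr; linarith

theorem phi_meas (μ : ℝ) : Measurable (fun t : ℝ => (1 - Real.exp (-(μ * t))) / t) := by
  fun_prop

theorem phi_contAt (μ : ℝ) {t : ℝ} (ht : 0 < t) :
    ContDiffAt ℝ (⊤ : ℕ∞) (fun t : ℝ => (1 - Real.exp (-(μ * t))) / t) t := by
  apply ContDiffAt.div _ contDiffAt_id ht.ne'
  fun_prop

theorem phi_ii {μ : ℝ} (hμ : 0 < μ) {a b : ℝ} (ha : 0 ≤ a) (hab : a ≤ b) :
    IntervalIntegrable (fun t : ℝ => (1 - Real.exp (-(μ * t))) / t) volume a b := by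
  rw [intervalIntegrable_iff_integrableOn_Ioc_of_le hab]
  refine Measure.integrableOn_of_bounded (M := μ) (by simp) (phi_meas μ).aestronglyMeasurable ?_
  rw [ae_restrict_iff' measurableSet_Ioc]
  refine Filter.Eventually.of_forall fun t ht => ?_
  have ht0 : 0 < t := lt_of_le_of_lt ha ht.1
  have := one_sub_exp_bounds hμ ht0
  rw [Real.norm_of_nonneg this.1]
  exact this.2.1

theorem phi_int_deriv {μ : ℝ} (hμ : 0 < μ) {r : ℝ} (hr : 0 < r) :
    HasDerivAt (fun r => ∫ t in (0:ℝ)..r, (1 - Real.exp (-(μ * t))) / t)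
      ((1 - Real.exp (-(μ * r))) / r) r := by
  apply intervalIntegral.integral_hasDerivAt_right (phi_ii hμ le_rfl hr.le)
  · exact (phi_meas μ).stronglyMeasurable.stronglyMeasurableAtFilter
  · exact (phi_contAt μ hr).continuousAt

theorem phi_int_contDiff {μ : ℝ} (hμ : 0 < μ) :
    ContDiffOn ℝ (⊤ : ℕ∞) (fun r => ∫ t in (0:ℝ)..r, (1 - Real.exp (-(μ * t))) / t) (Ioi 0) := by
  rw [contDiffOn_infty_iff_deriv_of_isOpen isOpen_Ioi]
  refine ⟨fun r hr => (phi_int_deriv hμ hr).differentiableAt.differentiableWithinAt, ?_⟩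
  have : ContDiffOn ℝ (⊤ : ℕ∞) (fun t : ℝ => (1 - Real.exp (-(μ * t))) / t) (Ioi 0) :=
    fun t ht => (phi_contAt μ ht).contDiffWithinAt
  exact this.congr fun r hr => (phi_int_deriv hμ hr).deriv

theorem phi_contDiffAt {μ : ℝ} (hμ : 0 < μ) {r : ℝ} (hr : 0 < r) :
    ContDiffAt ℝ (⊤ : ℕ∞) (phiW μ) r := by
  have := (phi_int_contDiff hμ).contDiffAt (Ioi_mem_nhds hr)
  exact contDiffAt_id.mul (this.neg.exp)

theorem phi_pos (μ : ℝ) {r : ℝ} (hr : 0 < r) : 0 < phiW μ r :=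
  mul_pos hr (Real.exp_pos _)

theorem phi_hasDerivAt {μ : ℝ} (hμ : 0 < μ) {r : ℝ} (hr : 0 < r) :
    HasDerivAt (phiW μ) (phiW μ r * (Real.exp (-(μ * r)) / r)) r := by
  have h := (hasDerivAt_id r).mul (phi_int_deriv hμ hr).neg.exp
  refine h.congr_deriv ?_
  simp only [phiW, id, Pi.neg_apply]
  field_simp
  ring

theorem phi_le {μ : ℝ} (hμ : 0 < μ) {r : ℝ} (hr : 0 ≤ r) : phiW μ r ≤ r := by
  unfold phiW
  apply mul_le_of_le_one_right hr
  rw [Real.exp_le_one_iff, neg_nonpos]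
  apply intervalIntegral.integral_nonneg_of_ae_restrict hr
  rw [Filter.EventuallyLE, ae_restrict_iff' measurableSet_Icc]
  have : ∀ᵐ t : ℝ, t ≠ 0 := by simp [ae_iff]
  filter_upwards [this] with t ht0 ht
  exact (one_sub_exp_bounds hμ (lt_of_le_of_ne ht.1 (Ne.symm ht0))).1

theorem phi_int_le {μ : ℝ} (hμ : 0 < μ) {r : ℝ} (hr : 0 ≤ r) :
    (∫ t in (0:ℝ)..r, (1 - Real.exp (-(μ * t))) / t) ≤ μ * r := by
  have : (∫ t in (0:ℝ)..r, (1 - Real.exp (-(μ * t))) / t) ≤ ∫ t in (0:ℝ)..r, μ := by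
    apply intervalIntegral.integral_mono_on_of_le_Ioo hr (phi_ii hμ le_rfl hr) (by simp)
    intro t ht
    exact (one_sub_exp_bounds hμ ht.1).2.1
  simpa [mul_comm] using this

theorem phi_int_le' {μ : ℝ} (hμ : 0 < μ) {r : ℝ} (hr : 1 ≤ μ * r) :
    (∫ t in (0:ℝ)..r, (1 - Real.exp (-(μ * t))) / t) ≤ 1 + Real.log (μ * r) := by
  have hr0 : 0 < r := by
    by_contra h
    push Not at h
    nlinarith
  have hi : μ⁻¹ ≤ r := by rw [inv_le_iff_one_le_mul₀ hμ]; linarith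
  have hi0 : 0 < μ⁻¹ := by positivity
  rw [← intervalIntegral.integral_add_adjacent_intervals (b := μ⁻¹)
    (phi_ii hμ le_rfl hi0.le) (phi_ii hμ hi0.le hi)]
  have h1 := phi_int_le hμ hi0.le
  rw [mul_inv_cancel₀ hμ.ne'] at h1
  have h2 : (∫ t in (μ⁻¹)..r, (1 - Real.exp (-(μ * t))) / t) ≤ ∫ t in (μ⁻¹)..r, 1 / t := by
    apply intervalIntegral.integral_mono_on_of_le_Ioo hi (phi_ii hμ hi0.le hi)
    · apply intervalIntegral.intervalIntegrable_one_div _ continuousOn_id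
      intro x hx
      rw [uIcc_of_le hi] at hx
      exact (lt_of_lt_of_le hi0 hx.1).ne'
    · intro t ht
      exact (one_sub_exp_bounds hμ (hi0.trans ht.1)).2.2
  rw [integral_one_div_of_pos hi0 hr0] at h2
  have : r / μ⁻¹ = μ * r := by field_simp
  rw [this] at h2
  linarith

theorem phi_ge {μ θE : ℝ} (hμ : 0 < μ) {r : ℝ} (hr : 0 < r) (hr1 : r ≤ Real.sqrt θE) :
    r ≤ mu1Of θE μ * phiW μ r := by
  have key : (∫ t in (0:ℝ)..r, (1 - Real.exp (-(μ * t))) / t) ≤ Real.log (mu1Of θE μ) := by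
    have h0 : μ * r ≤ μ * Real.sqrt θE := by gcongr
    unfold mu1Of
    split_ifs with h
    · rw [Real.log_exp]
      exact (phi_int_le hμ hr.le).trans h0
    · push Not at h
      rw [Real.log_mul (Real.exp_pos 1).ne' (by linarith), Real.log_exp]
      by_cases h1 : 1 ≤ μ * r
      · refine (phi_int_le' hμ h1).trans ?_
        have := Real.log_le_log (by linarith) h0
        linarith
      · have := phi_int_le hμ hr.le
        have := Real.log_nonneg h.le
        linarith
  have hpos : 0 < mu1Of θE μ := by
    unfold mu1Of
    split_ifs with h
    · exact Real.exp_pos _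
    · push Not at h
      have := Real.exp_pos 1
      positivity
  unfold phiW
  have e : mu1Of θE μ = Real.exp (Real.log (mu1Of θE μ)) := (Real.exp_log hpos).symm
  rw [e, mul_left_comm, ← Real.exp_add]
  apply le_mul_of_one_le_right hr.le
  rw [Real.one_le_exp_iff]
  linarith

theorem mu1_ge_one {μ θE : ℝ} (hμ : 0 < μ) : 1 ≤ mu1Of θE μ := by
  unfold mu1Of
  split_ifs with h
  · rw [Real.one_le_exp_iff]; positivity
  · push Not at h
    have := Real.add_one_le_exp (1:ℝ)
    nlinarith

section CarlemanGeneral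
open scoped RealInnerProductSpace

/-- Trace of an endomorphism of Euclidean space. -/
def trE {d : ℕ} (M : EucSp d →L[ℝ] EucSp d) : ℝ := ∑ i, (M (EuclideanSpace.single i 1)) i

theorem trE_add {d : ℕ} (M N : EucSp d →L[ℝ] EucSp d) : trE (M + N) = trE M + trE N := by
  simp [trE, Finset.sum_add_distrib]

theorem trE_sub {d : ℕ} (M N : EucSp d →L[ℝ] EucSp d) : trE (M - N) = trE M - trE N := by
  simp [trE, Finset.sum_sub_distrib]

theorem trE_smul {d : ℕ} (c : ℝ) (M : EucSp d →L[ℝ] EucSp d) : trE (c • M) = c * trE M := by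
  simp [trE, Finset.mul_sum]

theorem trE_id {d : ℕ} : trE (ContinuousLinearMap.id ℝ (EucSp d)) = d := by
  simp [trE]

theorem trE_smulRight {d : ℕ} (φ : EucSp d →L[ℝ] ℝ) (a : EucSp d) :
    trE (φ.smulRight a) = φ a := by
  have h : a = ∑ i, a i • EuclideanSpace.single i (1:ℝ) := by
    ext j
    simp [Finset.sum_apply, Pi.single_apply]
  conv_rhs => rw [h]
  simp [trE, mul_comm]

theorem trE_abs_le {d : ℕ} (M : EucSp d →L[ℝ] EucSp d) : |trE M| ≤ d * ‖M‖ := by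
  unfold trE
  calc _ ≤ ∑ i, |(M (EuclideanSpace.single i 1)) i| := Finset.abs_sum_le_sum_abs _ _
    _ ≤ ∑ i : Fin d, ‖M‖ := by
      apply Finset.sum_le_sum
      intro i _
      have h1 := PiLp.norm_apply_le (M (EuclideanSpace.single i 1)) i
      have h2 := M.le_opNorm (EuclideanSpace.single i 1)
      simp at h2
      rw [Real.norm_eq_abs] at h1
      exact h1.trans h2
    _ = d * ‖M‖ := by simp

/-- Abstract coefficient hypotheses. -/
structure CSet (d : ℕ) (s L : ℝ) (𝒜 : EucSp d → EucSp d →L[ℝ] EucSp d)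
    (B : EucSp d →L[ℝ] EucSp d) : Prop where
  hs : 1 ≤ s
  hL : 0 ≤ L
  symm : ∀ x a b, ⟪𝒜 x a, b⟫ = ⟪a, 𝒜 x b⟫
  lower : ∀ x a, ‖a‖ ^ 2 ≤ s ^ 2 * ⟪𝒜 x a, a⟫
  upper : ∀ x a, ⟪𝒜 x a, a⟫ ≤ s ^ 2 * ‖a‖ ^ 2
  lip : ∀ x y, ‖𝒜 x - 𝒜 y‖ ≤ L * ‖x - y‖
  AB : ∀ v, 𝒜 0 (B v) = v
  BA : ∀ v, B (𝒜 0 v) = v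

theorem inner_matrix {d : ℕ} (M : Matrix (Fin d) (Fin d) ℝ) (a b : EucSp d) :
    ⟪a, Matrix.toEuclideanCLM (𝕜 := ℝ) M b⟫ = ∑ i, ∑ j, a i * M i j * b j := by
  rw [Matrix.inner_toEuclideanCLM]
  simp [dotProduct, Matrix.mulVec, Finset.mul_sum, mul_assoc]

theorem opNorm_le_rowSum {d : ℕ} (M : Matrix (Fin d) (Fin d) ℝ) (hM : ∀ i j, M i j = M j i) :
    ‖Matrix.toEuclideanCLM (𝕜 := ℝ) M‖ ≤ rowSumNorm M := by
  have hR : ∀ i, ∑ j, |M i j| ≤ rowSumNorm M := fun i =>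
    le_ciSup (f := fun i => ∑ j, |M i j|) (Set.finite_range _).bddAbove i
  have hR0 : 0 ≤ rowSumNorm M := by
    apply Real.iSup_nonneg; intro i; positivity
  apply ContinuousLinearMap.opNorm_le_bound _ hR0
  intro v
  apply abs_le_of_sq_le_sq' _ (by positivity) |>.2
  rw [mul_pow, EuclideanSpace.norm_sq_eq, EuclideanSpace.norm_sq_eq]
  have h1 : ∀ i, ‖(Matrix.toEuclideanCLM (𝕜 := ℝ) M v) i‖ ^ 2
      ≤ rowSumNorm M * ∑ j, |M i j| * (v j) ^ 2 := by
    intro i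
    have e : (Matrix.toEuclideanCLM (𝕜 := ℝ) M v) i = ∑ j, M i j * v j := by
      rw [Matrix.ofLp_toEuclideanCLM]; rfl
    rw [e, Real.norm_eq_abs, sq_abs]
    have := Finset.sum_sq_le_sum_mul_sum_of_sq_le_mul (s := Finset.univ) (r := fun j => M i j * v j)
      (f := fun j => |M i j|) (g := fun j => |M i j| * (v j) ^ 2) (fun _ _ => by positivity)
      (fun _ _ => by positivity) (fun j _ => by
        rw [mul_pow, ← mul_assoc, ← sq, sq_abs])
    exact this.trans (mul_le_mul_of_nonneg_right (hR i) (by positivity))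
  calc _ ≤ ∑ i, rowSumNorm M * ∑ j, |M i j| * (v j) ^ 2 := Finset.sum_le_sum fun i _ => h1 i
    _ = rowSumNorm M * ∑ j, (∑ i, |M j i|) * (v j) ^ 2 := by
      rw [← Finset.mul_sum, Finset.sum_comm]
      simp_rw [Finset.sum_mul]
      congr 1
      refine Finset.sum_congr rfl fun j _ => Finset.sum_congr rfl fun i _ => ?_
      rw [hM i j]
    _ ≤ rowSumNorm M * ∑ j, rowSumNorm M * (v j) ^ 2 := by
      gcongr with j _
      exact hR j
    _ = _ := by simp [← Finset.mul_sum]; ring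

theorem cset_of {d : ℕ} {θE θL : ℝ} (hθE : 1 ≤ θE) (hθL : 0 ≤ θL)
    {A : EucSp d → Matrix (Fin d) (Fin d) ℝ}
    (hAs : IsSymmA A univ) (hAe : IsElliptic θE A univ) (hAl : IsLipA θL A univ) :
    CSet d (Real.sqrt θE) θL (fun x => Matrix.toEuclideanCLM (𝕜 := ℝ) (A x))
      (Matrix.toEuclideanCLM (𝕜 := ℝ) (A 0)⁻¹) := by
  have hlow : ∀ x (a : EucSp d), ‖a‖ ^ 2 ≤ θE * ⟪a, Matrix.toEuclideanCLM (𝕜 := ℝ) (A x) a⟫ := by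
    intro x a
    rw [inner_matrix]
    have h := (hAe x (mem_univ _) a).1
    rw [EuclideanSpace.norm_sq_eq]
    simp only [Real.norm_eq_abs, sq_abs]
    rw [inv_mul_le_iff₀ (by linarith)] at h
    exact h
  have hdet : IsUnit (A 0).det := by
    rw [← Matrix.isUnit_iff_isUnit_det, ← Matrix.mulVec_injective_iff_isUnit]
    change Function.Injective (Matrix.mulVecLin (A 0))
    rw [injective_iff_map_eq_zero (Matrix.mulVecLin (A 0))]
    intro v hv
    have h := hlow 0 (WithLp.toLp 2 v)
    rw [Matrix.toEuclideanCLM_toLp] at h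
    rw [Matrix.mulVecLin_apply] at hv
    rw [hv] at h
    simp at h
    exact h
  have hsq : Real.sqrt θE ^ 2 = θE := Real.sq_sqrt (by linarith)
  refine ⟨by rw [Real.one_le_sqrt]; exact hθE, hθL, ?_, ?_, ?_, ?_, ?_, ?_⟩
  · intro x a b
    rw [real_inner_comm, inner_matrix, inner_matrix, Finset.sum_comm]
    refine Finset.sum_congr rfl fun i _ => Finset.sum_congr rfl fun j _ => ?_
    rw [hAs x (mem_univ _) i j]; ring
  · intro x a
    rw [real_inner_comm, hsq]; exact hlow x a
  · intro x a
    rw [real_inner_comm, hsq, inner_matrix]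
    have h := (hAe x (mem_univ _) a).2
    rw [EuclideanSpace.norm_sq_eq]
    simp only [Real.norm_eq_abs, sq_abs]
    exact h
  · intro x y
    rw [← map_sub]
    refine (opNorm_le_rowSum _ ?_).trans (hAl x (mem_univ _) y (mem_univ _))
    intro i j
    rw [Matrix.sub_apply, Matrix.sub_apply, hAs x (mem_univ _), hAs y (mem_univ _)]
  · intro v
    change (Matrix.toEuclideanCLM (𝕜 := ℝ) (A 0) * Matrix.toEuclideanCLM (𝕜 := ℝ) (A 0)⁻¹) v = v
    rw [← map_mul, Matrix.mul_nonsing_inv _ hdet]; simp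
  · intro v
    change (Matrix.toEuclideanCLM (𝕜 := ℝ) (A 0)⁻¹ * Matrix.toEuclideanCLM (𝕜 := ℝ) (A 0)) v = v
    rw [← map_mul, Matrix.nonsing_inv_mul _ hdet]; simp

theorem sigma_eq {d : ℕ} (A : EucSp d → Matrix (Fin d) (Fin d) ℝ) (x : EucSp d) :
    sigmaA A x = Real.sqrt ⟪Matrix.toEuclideanCLM (𝕜 := ℝ) (A 0)⁻¹ x, x⟫ := by
  rw [real_inner_comm, inner_matrix]; rfl

end CarlemanGeneral

section CarlemanBounds
open scoped RealInnerProductSpace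

namespace CSet
variable {d : ℕ} {s L : ℝ} {𝒜 : EucSp d → EucSp d →L[ℝ] EucSp d} {B : EucSp d →L[ℝ] EucSp d}

theorem nonneg (h : CSet d s L 𝒜 B) (x a : EucSp d) : 0 ≤ ⟪𝒜 x a, a⟫ := by
  have h1 := h.lower x a
  have hs := h.hs
  by_contra hc
  push Not at hc
  have : s ^ 2 * ⟪𝒜 x a, a⟫ < 0 := mul_neg_of_pos_of_neg (by positivity) hc
  have := sq_nonneg ‖a‖
  linarith

theorem normSq (h : CSet d s L 𝒜 B) (x a : EucSp d) : ‖𝒜 x a‖ ^ 2 ≤ s ^ 2 * ⟪𝒜 x a, a⟫ := by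
  have hs := h.hs
  set p := 𝒜 x a with hp
  have h1 := h.nonneg x (s ^ 2 • a - p)
  have h2 := h.upper x p
  have h3 : ⟪𝒜 x p, a⟫ = ‖p‖ ^ 2 := by
    rw [h.symm, ← hp, real_inner_self_eq_norm_sq]
  have h4 : ⟪𝒜 x (s ^ 2 • a - p), s ^ 2 • a - p⟫
      = s ^ 4 * ⟪p, a⟫ - 2 * s ^ 2 * ‖p‖ ^ 2 + ⟪𝒜 x p, p⟫ := by
    simp only [map_sub, map_smul, inner_sub_left, inner_sub_right, inner_smul_left,
      inner_smul_right, ← hp, h3, real_inner_self_eq_norm_sq]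
    simp
    ring
  rw [h4] at h1
  have h5 : s ^ 2 * (‖p‖ ^ 2) ≤ s ^ 2 * (s ^ 2 * ⟪p, a⟫) := by linarith
  exact le_of_mul_le_mul_left h5 (by positivity)

theorem norm_le (h : CSet d s L 𝒜 B) (x a : EucSp d) : ‖𝒜 x a‖ ≤ s ^ 2 * ‖a‖ := by
  have hs := h.hs
  have h1 := h.normSq x a
  have h2 := h.upper x a
  apply abs_le_of_sq_le_sq' _ (by positivity) |>.2
  nlinarith [sq_nonneg s]

theorem norm_mul (h : CSet d s L 𝒜 B) (x a : EucSp d) : ‖a‖ * ‖𝒜 x a‖ ≤ s ^ 2 * ⟪𝒜 x a, a⟫ := by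
  have h1 := h.normSq x a
  have h2 := h.lower x a
  nlinarith [sq_nonneg (‖a‖ - ‖𝒜 x a‖)]

theorem normB (h : CSet d s L 𝒜 B) (v : EucSp d) : ‖B v‖ ≤ s ^ 2 * ‖v‖ := by
  have hs := h.hs
  have h1 := h.lower 0 (B v)
  rw [h.AB] at h1
  have h2 := real_inner_le_norm v (B v)
  by_cases h0 : ‖B v‖ = 0
  · rw [h0]; positivity
  have h3 : 0 < ‖B v‖ := lt_of_le_of_ne (norm_nonneg _) (Ne.symm h0)
  have : ‖B v‖ * ‖B v‖ ≤ (s ^ 2 * ‖v‖) * ‖B v‖ := by nlinarith [sq_nonneg s]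
  exact le_of_mul_le_mul_right this h3

theorem opB (h : CSet d s L 𝒜 B) : ‖B‖ ≤ s ^ 2 :=
  B.opNorm_le_bound (sq_nonneg _) h.normB

theorem symmB (h : CSet d s L 𝒜 B) (a b : EucSp d) : ⟪B a, b⟫ = ⟪a, B b⟫ := by
  have := h.symm 0 (B a) (B b)
  rw [h.AB, h.AB] at this
  exact this.symm

theorem sigma_nonneg (h : CSet d s L 𝒜 B) (x : EucSp d) : 0 ≤ ⟪B x, x⟫ := by
  have := h.nonneg 0 (B x)
  rw [h.AB] at this
  rwa [real_inner_comm]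

theorem sigma_pos (h : CSet d s L 𝒜 B) {x : EucSp d} (hx : x ≠ 0) : 0 < ⟪B x, x⟫ := by
  have hs := h.hs
  have h1 := h.normSq 0 (B x)
  rw [h.AB, real_inner_comm] at h1
  have : 0 < ‖x‖ ^ 2 := by positivity
  by_contra hc
  push Not at hc
  nlinarith [sq_nonneg s]

theorem sigma_le (h : CSet d s L 𝒜 B) (x : EucSp d) : ⟪B x, x⟫ ≤ s ^ 2 * ‖x‖ ^ 2 := by
  have h1 := h.normB x
  have h2 := real_inner_le_norm (B x) x
  nlinarith [norm_nonneg x]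

theorem bounds (h : CSet d s L 𝒜 B) {x η : EucSp d} {σ κ : ℝ} (hσ : 0 < σ)
    (hσ2 : σ ^ 2 = ⟪B x, x⟫) (hκ : κ * s ^ 4 = 1)
    {A' : EucSp d →L[ℝ] EucSp d →L[ℝ] EucSp d} (hA' : ‖A'‖ ≤ L)
    {y z p : EucSp d} (hy : y = B x) (hz : z = 𝒜 x y) (hp : p = 𝒜 x η) :
    0 ≤ ⟪p, η⟫ ∧ κ * σ ^ 2 ≤ ⟪z, y⟫ ∧ ⟪z, y⟫ ≤ s ^ 4 * σ ^ 2 ∧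
    |trE (A'.flip y)| ≤ d * L * s * σ ∧
    |trE ((𝒜 x).comp B) - d| ≤ d * L * s ^ 3 * σ ∧
    |⟪z, y⟫ - σ ^ 2| ≤ L * s ^ 3 * σ ^ 3 ∧
    |⟪B p, p⟫ - ⟪p, η⟫| ≤ L * s ^ 5 * σ * ⟪p, η⟫ ∧
    |⟪A' p y, η⟫| ≤ L * s ^ 3 * σ * ⟪p, η⟫ ∧
    |⟪A' z η, η⟫| ≤ L * s ^ 5 * σ * ⟪p, η⟫ ∧
    |⟪B z, z⟫ - ⟪z, y⟫| ≤ L * s ^ 5 * σ * ⟪z, y⟫ ∧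
    |⟪A' z y, y⟫| ≤ L * s ^ 3 * σ * ⟪z, y⟫ := by
  have hs := h.hs
  have hL := h.hL
  have hs0 : 0 < s := by linarith
  have hκ0 : κ = 1 / s ^ 4 := by field_simp; exact hκ
  have hAy : 𝒜 0 y = x := by rw [hy, h.AB]
  have hσy : ⟪𝒜 0 y, y⟫ = σ ^ 2 := by rw [hAy, hy, real_inner_comm, hσ2]
  have hyn : ‖y‖ ≤ s * σ := by
    apply abs_le_of_sq_le_sq' _ (by positivity) |>.2
    have := h.lower 0 y
    rw [hσy] at this; linarith [mul_pow s σ 2]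
  have hxn : ‖x‖ ≤ s * σ := by
    apply abs_le_of_sq_le_sq' _ (by positivity) |>.2
    have := h.normSq 0 y
    rw [hσy, hAy] at this; linarith [mul_pow s σ 2]
  have hσn : σ ^ 2 ≤ s ^ 2 * ‖y‖ ^ 2 := by rw [← hσy]; exact h.upper 0 y
  have ha : 0 ≤ ⟪p, η⟫ := by rw [hp]; exact h.nonneg _ _
  have hG : 0 ≤ ⟪z, y⟫ := by rw [hz]; exact h.nonneg _ _
  have hηn : ‖η‖ ^ 2 ≤ s ^ 2 * ⟪p, η⟫ := by rw [hp]; exact h.lower _ _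
  have hηp : ‖η‖ * ‖p‖ ≤ s ^ 2 * ⟪p, η⟫ := by rw [hp]; exact h.norm_mul _ _
  have hyG : ‖y‖ ^ 2 ≤ s ^ 2 * ⟪z, y⟫ := by rw [hz]; exact h.lower _ _
  have hyz : ‖y‖ * ‖z‖ ≤ s ^ 2 * ⟪z, y⟫ := by rw [hz]; exact h.norm_mul _ _
  have hzn : ‖z‖ ≤ s ^ 3 * σ := by
    rw [hz]
    calc _ ≤ s ^ 2 * ‖y‖ := h.norm_le x y
      _ ≤ s ^ 2 * (s * σ) := by gcongr
      _ = _ := by ring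
  set D : EucSp d →L[ℝ] EucSp d := 𝒜 x - 𝒜 0 with hD
  have hDn : ‖D‖ ≤ L * (s * σ) := by
    have := h.lip x 0
    rw [sub_zero] at this
    exact this.trans (by gcongr)
  have hA3 : ∀ u v w : EucSp d, |⟪A' u v, w⟫| ≤ L * ‖u‖ * ‖v‖ * ‖w‖ := by
    intro u v w
    calc _ ≤ ‖A' u v‖ * ‖w‖ := abs_real_inner_le_norm _ _
      _ ≤ (‖A'‖ * ‖u‖ * ‖v‖) * ‖w‖ := by gcongr; exact A'.le_opNorm₂ u v
      _ ≤ _ := by gcongr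
  have hBD : ∀ v w : EucSp d, |⟪B (D v), w⟫| ≤ L * s ^ 3 * σ * (‖v‖ * ‖w‖) := by
    intro v w
    calc _ ≤ ‖B (D v)‖ * ‖w‖ := abs_real_inner_le_norm _ _
      _ ≤ (s ^ 2 * ((L * (s * σ)) * ‖v‖)) * ‖w‖ := by
        gcongr
        refine (h.normB _).trans ?_
        gcongr
        exact D.le_of_opNorm_le hDn v
      _ = _ := by ring
  refine ⟨ha, ?_, ?_, ?_, ?_, ?_, ?_, ?_, ?_, ?_, ?_⟩
  · rw [hκ0, one_div_mul_eq_div, div_le_iff₀ (by positivity)]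
    nlinarith [sq_nonneg s]
  · have := h.upper x y
    rw [← hz] at this
    calc _ ≤ s ^ 2 * ‖y‖ ^ 2 := this
      _ ≤ s ^ 2 * (s * σ) ^ 2 := by gcongr
      _ = _ := by ring
  · calc _ ≤ d * ‖A'.flip y‖ := trE_abs_le _
      _ ≤ d * (L * (s * σ)) := by
        gcongr
        calc _ ≤ ‖A'.flip‖ * ‖y‖ := A'.flip.le_opNorm y
          _ ≤ _ := by rw [ContinuousLinearMap.opNorm_flip]; gcongr
      _ = _ := by ring
  · have e : trE ((𝒜 x).comp B) - d = trE (D.comp B) := by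
      rw [← trE_id, ← trE_sub]
      congr 1
      ext v : 1
      simp [hD, h.AB]
    rw [e]
    calc _ ≤ d * ‖D.comp B‖ := trE_abs_le _
      _ ≤ d * ((L * (s * σ)) * s ^ 2) := by
        gcongr
        refine (D.opNorm_comp_le B).trans ?_
        gcongr
        exact h.opB
      _ = _ := by ring
  · have e : ⟪z, y⟫ - σ ^ 2 = ⟪D y, y⟫ := by
      rw [← hσy, hz, hD]; simp [inner_sub_left]
    rw [e]
    calc _ ≤ ‖D y‖ * ‖y‖ := abs_real_inner_le_norm _ _
      _ ≤ ((L * (s * σ)) * (s * σ)) * (s * σ) := by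
        gcongr
        exact (D.le_of_opNorm_le hDn y).trans (by gcongr)
      _ = _ := by ring
  · have e : ⟪B p, p⟫ - ⟪p, η⟫ = ⟪B (D η), p⟫ := by
      rw [hD, ContinuousLinearMap.sub_apply, map_sub, h.BA, inner_sub_left, ← hp,
        real_inner_comm η p]
    rw [e]
    calc _ ≤ L * s ^ 3 * σ * (‖η‖ * ‖p‖) := hBD _ _
      _ ≤ L * s ^ 3 * σ * (s ^ 2 * ⟪p, η⟫) := by gcongr
      _ = _ := by ring
  · calc _ ≤ L * ‖p‖ * ‖y‖ * ‖η‖ := hA3 _ _ _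
      _ = L * ‖y‖ * (‖η‖ * ‖p‖) := by ring
      _ ≤ L * (s * σ) * (s ^ 2 * ⟪p, η⟫) := by gcongr
      _ = _ := by ring
  · calc _ ≤ L * ‖z‖ * ‖η‖ * ‖η‖ := hA3 _ _ _
      _ = L * ‖z‖ * (‖η‖ ^ 2) := by ring
      _ ≤ L * (s ^ 3 * σ) * (s ^ 2 * ⟪p, η⟫) := by gcongr
      _ = _ := by ring
  · have e : ⟪B z, z⟫ - ⟪z, y⟫ = ⟪B (D y), z⟫ := by
      rw [hD, ContinuousLinearMap.sub_apply, map_sub, h.BA, inner_sub_left, ← hz,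
        real_inner_comm y z]
    rw [e]
    calc _ ≤ L * s ^ 3 * σ * (‖y‖ * ‖z‖) := hBD _ _
      _ ≤ L * s ^ 3 * σ * (s ^ 2 * ⟪z, y⟫) := by gcongr
      _ = _ := by ring
  · calc _ ≤ L * ‖z‖ * ‖y‖ * ‖y‖ := hA3 _ _ _
      _ = L * ‖y‖ * (‖y‖ * ‖z‖) := by ring
      _ ≤ L * (s * σ) * (s ^ 2 * ⟪z, y⟫) := by gcongr
      _ = _ := by ring

end CSet
end CarlemanBounds

section CarlemanCalc
open scoped RealInnerProductSpace NNReal Topology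

theorem trE_continuous {d : ℕ} : Continuous (trE (d := d)) := by
  unfold trE
  fun_prop

/-- Divergence of a vector field. -/
def divE {d : ℕ} (X : EucSp d → EucSp d) (x : EucSp d) : ℝ := trE (fderiv ℝ X x)

theorem divE_measurable {d : ℕ} (X : EucSp d → EucSp d) : Measurable (divE X) := by
  exact trE_continuous.measurable.comp (measurable_fderiv ℝ X)

theorem divE_bound {d : ℕ} {X : EucSp d → EucSp d} {C : ℝ≥0} (hX : LipschitzWith C X)
    (x : EucSp d) : |divE X x| ≤ d * C := by
  refine (trE_abs_le _).trans ?_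
  gcongr
  exact norm_fderiv_le_of_lipschitz ℝ hX

theorem divE_zero {d : ℕ} {X : EucSp d → EucSp d} {x : EucSp d} (hx : x ∉ tsupport X) :
    divE X x = 0 := by
  have : fderiv ℝ X x = 0 := by
    by_contra hc
    exact hx (support_fderiv_subset ℝ hc)
  simp [divE, this, trE]

theorem divE_integrable {d : ℕ} {X : EucSp d → EucSp d} {C : ℝ≥0} (hX : LipschitzWith C X)
    (hc : HasCompactSupport X) : Integrable (divE X) := by
  rw [← integrableOn_iff_integrable_of_support_subset (s := tsupport X)]
  · exact Measure.integrableOn_of_bounded (M := d * C) (hc.isCompact.measure_lt_top.ne)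
      (divE_measurable X).aestronglyMeasurable (ae_of_all _ fun x => divE_bound hX x)
  · intro x hx
    by_contra h
    exact hx (divE_zero h)

theorem divE_integral {d : ℕ} {X : EucSp d → EucSp d} {C : ℝ≥0} (hX : LipschitzWith C X)
    (hc : HasCompactSupport X) : ∫ x, divE X x = 0 := by
  have hcomp : ∀ i : Fin d, ∃ D, LipschitzWith D (fun x => X x i) := by
    intro i
    exact ⟨_, ((EuclideanSpace.proj i : EucSp d →L[ℝ] ℝ).lipschitz).comp hX⟩
  have hzero : ∀ i : Fin d, ∫ x, fderiv ℝ (fun x => X x i) x (EuclideanSpace.single i 1) = 0 := by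
    intro i
    obtain ⟨D, hD⟩ := hcomp i
    have hcs : HasCompactSupport (fun x => X x i) :=
      hc.comp_left (g := fun v : EucSp d => v i) (by simp)
    have h := LipschitzWith.integral_lineDeriv_mul_eq (μ := volume)
      (LipschitzWith.const (1:ℝ)) hD hcs (-(EuclideanSpace.single i (1:ℝ)))
    simp only [neg_neg, mul_one] at h
    have h2 : ∀ x, lineDeriv ℝ (fun _ : EucSp d => (1:ℝ)) x (-(EuclideanSpace.single i (1:ℝ))) = 0 := by
      intro x; simp [lineDeriv]
    simp only [h2, zero_mul, integral_zero] at h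
    rw [h]
    apply integral_congr_ae
    filter_upwards [hD.ae_differentiableAt (μ := volume)] with x hx
    rw [hx.lineDeriv_eq_fderiv]
  have hInt : ∀ i : Fin d, Integrable
      (fun x => fderiv ℝ (fun x => X x i) x (EuclideanSpace.single i 1)) := by
    intro i
    obtain ⟨D, hD⟩ := hcomp i
    have hcs : HasCompactSupport (fun x => X x i) :=
      hc.comp_left (g := fun v : EucSp d => v i) (by simp)
    rw [← integrableOn_iff_integrable_of_support_subset (s := tsupport (fun x => X x i))]
    · refine Measure.integrableOn_of_bounded (M := D) (hcs.isCompact.measure_lt_top.ne)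
        (measurable_fderiv_apply_const ℝ _ _).aestronglyMeasurable (ae_of_all _ fun x => ?_)
      have h1 := (fderiv ℝ (fun x => X x i) x).le_of_opNorm_le
        (norm_fderiv_le_of_lipschitz ℝ hD) (EuclideanSpace.single i 1)
      simpa using h1
    · intro x hx
      by_contra h
      apply hx
      have : fderiv ℝ (fun x => X x i) x = 0 := by
        by_contra hc
        exact h (support_fderiv_subset ℝ hc)
      simp [this]
  have e : ∫ x, divE X x
      = ∫ x, ∑ i, fderiv ℝ (fun x => X x i) x (EuclideanSpace.single i 1) := by
    apply integral_congr_ae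
    filter_upwards [hX.ae_differentiableAt (μ := volume)] with x hx
    unfold divE trE
    refine Finset.sum_congr rfl fun i _ => ?_
    have := ((EuclideanSpace.proj i : EucSp d →L[ℝ] ℝ).hasFDerivAt.comp x hx.hasFDerivAt).fderiv
    change fderiv ℝ (fun x => X x i) x = _ at this
    rw [this]; rfl
  rw [e, integral_finsetSum _ fun i _ => hInt i]
  exact Finset.sum_eq_zero fun i _ => hzero i

/-- Composition of a C¹ function with a bounded Lipschitz coefficient field. -/
theorem lip_comp {d : ℕ} {G F : Type*} [NormedAddCommGroup G] [NormedSpace ℝ G]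
    [FiniteDimensional ℝ G] [NormedAddCommGroup F] [NormedSpace ℝ F]
    {𝒜 : EucSp d → G} {L : ℝ≥0} (h𝒜 : LipschitzWith L 𝒜) {R : ℝ} (hR : ∀ x, ‖𝒜 x‖ ≤ R)
    {Ψ : G × EucSp d → F} (hΨ : ContDiff ℝ 1 Ψ) {K : Set (EucSp d)} (hK : IsCompact K)
    (hΨK : ∀ M x, x ∉ K → Ψ (M, x) = 0) :
    ∃ C, LipschitzWith C (fun x => Ψ (𝒜 x, x)) := by
  have hR0 : 0 ≤ R := (norm_nonneg _).trans (hR 0)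
  let χ : ContDiffBump (0 : G) := ⟨R + 1, R + 2, by linarith, by linarith⟩
  let Φ : G × EucSp d → F := fun q => χ q.1 • Ψ q
  have h1 : ContDiff ℝ 1 Φ := (χ.contDiff.comp contDiff_fst).smul hΨ
  have h2 : HasCompactSupport Φ := by
    apply HasCompactSupport.intro ((isCompact_closedBall (0:G) (R+2)).prod hK)
    rintro ⟨M, x⟩ hq
    simp only [Set.mem_prod, not_and_or] at hq
    rcases hq with hq | hq
    · have : χ M = 0 := by
        apply χ.zero_of_le_dist
        simp only [Metric.mem_closedBall, not_le] at hq
        exact hq.le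
      simp [Φ, this]
    · simp [Φ, hΨK M x hq]
  obtain ⟨C, hC⟩ := ContDiff.lipschitzWith_of_hasCompactSupport h2 h1 one_ne_zero
  refine ⟨C * max L 1, ?_⟩
  convert hC.comp (h𝒜.prodMk LipschitzWith.id) using 1
  funext x
  have : χ (𝒜 x) = 1 := by
    apply χ.one_of_mem_closedBall
    simp only [Metric.mem_closedBall, dist_zero_right]
    have := hR x
    change _ ≤ R + 1
    linarith
  simp [Φ, this]

end CarlemanCalc

section CarlemanDiv
open scoped RealInnerProductSpace NNReal Topology

theorem divE_comb {d : ℕ} {φ ψ : EucSp d → ℝ} {X Z : EucSp d → EucSp d}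
    {φ' ψ' : EucSp d →L[ℝ] ℝ} {X' Z' : EucSp d →L[ℝ] EucSp d} {x : EucSp d}
    (hφ : HasFDerivAt φ φ' x) (hψ : HasFDerivAt ψ ψ' x)
    (hX : HasFDerivAt X X' x) (hZ : HasFDerivAt Z Z' x) :
    divE (fun x => φ x • X x + ψ x • Z x) x
      = φ x * trE X' + φ' (X x) + (ψ x * trE Z' + ψ' (Z x)) := by
  have h := (hφ.smul hX).add (hψ.smul hZ)
  unfold divE
  have e : fderiv ℝ (fun x => φ x • X x + ψ x • Z x) x = _ := h.fderiv
  rw [e]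
  simp only [trE_add, trE_smul, trE_smulRight]

theorem divE_V {d : ℕ} {s L : ℝ} {𝒜 : EucSp d → EucSp d →L[ℝ] EucSp d}
    {B : EucSp d →L[ℝ] EucSp d} (h : CSet d s L 𝒜 B)
    {f g1 g2 : EucSp d → ℝ} {η : EucSp d → EucSp d} {x : EucSp d}
    {A' : EucSp d →L[ℝ] EucSp d →L[ℝ] EucSp d} {H : EucSp d →L[ℝ] EucSp d} {c1 c2 k : ℝ}
    (hA : HasFDerivAt 𝒜 A' x) (hη : HasFDerivAt η H x) (hH : ∀ u v, ⟪H u, v⟫ = ⟪u, H v⟫)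
    (hf : HasFDerivAt f (innerSL ℝ (η x)) x)
    (hg1 : HasFDerivAt g1 (c1 • innerSL ℝ (B x)) x)
    (hg2 : HasFDerivAt g2 (c2 • innerSL ℝ (B x)) x)
    {y z p : EucSp d} (hy : y = B x) (hz : z = 𝒜 x y) (hp : p = 𝒜 x (η x))
    {Lf τ1 τ2 : ℝ} (hLf : Lf = trE ((𝒜 x).comp H + A'.flip (η x)))
    (hτ1 : τ1 = trE (A'.flip y)) (hτ2 : τ2 = trE ((𝒜 x).comp B)) :
    divE (fun x => (g1 x * (⟪𝒜 x (B x), η x⟫ + k * f x)) • 𝒜 x (η x)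
      + (g2 x * (⟪𝒜 x (B x), B x⟫ * f x ^ 2) - g1 x * (⟪𝒜 x (η x), η x⟫ / 2)) • 𝒜 x (B x)) x
    = c1 * (⟪z, η x⟫ ^ 2 - ⟪p, η x⟫ * ⟪z, y⟫ / 2 + k * f x * ⟪z, η x⟫)
      + g1 x * (⟪z, η x⟫ * Lf + ⟪A' p y, η x⟫ + ⟪B p, p⟫ - ⟪p, η x⟫ * (τ1 + τ2) / 2
          - ⟪A' z (η x), η x⟫ / 2 + k * ⟪p, η x⟫ + k * f x * Lf)
      + (c2 * ⟪z, y⟫ ^ 2 * f x ^ 2 + g2 x * (f x ^ 2 * (⟪A' z y, y⟫ + 2 * ⟪B z, z⟫)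
          + 2 * ⟪z, y⟫ * f x * ⟪z, η x⟫ + ⟪z, y⟫ * f x ^ 2 * (τ1 + τ2))) := by
  have hP := hA.clm_apply hη
  have hZ := hA.clm_apply (B.hasFDerivAt (x := x))
  have hb := hZ.inner ℝ hη
  have ha := hP.inner ℝ hη
  have hG := hZ.inner ℝ (B.hasFDerivAt (x := x))
  have hφ := hg1.mul (hb.add (hf.const_mul k))
  have hψ := (hg2.mul (hG.mul (hf.pow 2))).sub (hg1.mul (ha.mul_const (1/2)))
  have key := divE_comb hφ hψ hP hZ
  have e : (fun x => (g1 x * (⟪𝒜 x (B x), η x⟫ + k * f x)) • 𝒜 x (η x)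
      + (g2 x * (⟪𝒜 x (B x), B x⟫ * f x ^ 2) - g1 x * (⟪𝒜 x (η x), η x⟫ / 2)) • 𝒜 x (B x))
     = (fun x => (g1 x * (⟪𝒜 x (B x), η x⟫ + k * f x)) • 𝒜 x (η x)
      + (g2 x * (⟪𝒜 x (B x), B x⟫ * f x ^ 2) - g1 x * (⟪𝒜 x (η x), η x⟫ * (1/2))) • 𝒜 x (B x)) := by
    funext x; congr 2; ring
  rw [e]
  refine key.trans ?_
  have hZt : trE ((𝒜 x).comp B + A'.flip (B x)) = τ1 + τ2 := by
    rw [trE_add, hτ1, hτ2, hy, add_comm]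
  rw [← hLf, hZt]
  simp only [Pi.mul_apply, Pi.add_apply, Pi.sub_apply, Pi.pow_apply]
  simp only [_root_.add_apply, _root_.sub_apply, _root_.smul_apply, smul_eq_mul,
    fderivInnerCLM_apply, ContinuousLinearMap.comp_apply, ContinuousLinearMap.prod_apply,
    ContinuousLinearMap.flip_apply, innerSL_apply_apply, ← hy, ← hz, ← hp, inner_add_left,
    nsmul_eq_mul]
  have r1 : ⟪y, p⟫ = ⟪z, η x⟫ := by rw [hp, ← h.symm, ← hz]
  have r2 : ⟪y, z⟫ = ⟪z, y⟫ := real_inner_comm _ _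
  have r3 : ⟪η x, p⟫ = ⟪p, η x⟫ := real_inner_comm _ _
  have r4 : ⟪η x, z⟫ = ⟪z, η x⟫ := real_inner_comm _ _
  have r5 : ⟪𝒜 x (B p), η x⟫ = ⟪B p, p⟫ := by rw [h.symm, ← hp]
  have r6 : ⟪𝒜 x (B z), y⟫ = ⟪B z, z⟫ := by rw [h.symm, ← hz]
  have r7 : ⟪z, B z⟫ = ⟪B z, z⟫ := real_inner_comm _ _
  have r8 : ⟪𝒜 x (H z), η x⟫ = ⟪z, H p⟫ := by rw [h.symm, ← hp, hH]
  have r9 : ⟪p, H z⟫ = ⟪z, H p⟫ := by rw [← hH, real_inner_comm]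
  simp only [r1, r2, r3, r4, r5, r6, r7, r8, r9]
  push_cast
  ring

theorem divE_P {d : ℕ} {s L : ℝ} {𝒜 : EucSp d → EucSp d →L[ℝ] EucSp d}
    {B : EucSp d →L[ℝ] EucSp d} (h : CSet d s L 𝒜 B)
    {f g1 g2 : EucSp d → ℝ} {η : EucSp d → EucSp d} {x : EucSp d}
    {A' : EucSp d →L[ℝ] EucSp d →L[ℝ] EucSp d} {H : EucSp d →L[ℝ] EucSp d} {c1 c2 : ℝ}
    (hA : HasFDerivAt 𝒜 A' x) (hη : HasFDerivAt η H x)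
    (hf : HasFDerivAt f (innerSL ℝ (η x)) x)
    (hg1 : HasFDerivAt g1 (c1 • innerSL ℝ (B x)) x)
    (hg2 : HasFDerivAt g2 (c2 • innerSL ℝ (B x)) x)
    {y z : EucSp d} (hy : y = B x) (hz : z = 𝒜 x y)
    {Lf τ1 τ2 : ℝ} (hLf : Lf = trE ((𝒜 x).comp H + A'.flip (η x)))
    (hτ1 : τ1 = trE (A'.flip y)) (hτ2 : τ2 = trE ((𝒜 x).comp B)) :
    divE (fun x => g1 x • 𝒜 x (η x) + (g1 x * (f x * g2 x)) • 𝒜 x (B x)) x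
    = g1 x * Lf + c1 * ⟪z, η x⟫ + g1 x * (f x * g2 x) * (τ1 + τ2)
      + (c1 * f x * g2 x * ⟪z, y⟫ + g1 x * (⟪z, η x⟫ * g2 x + f x * c2 * ⟪z, y⟫)) := by
  have hP := hA.clm_apply hη
  have hZ := hA.clm_apply (B.hasFDerivAt (x := x))
  have hψ := hg1.mul (hf.mul hg2)
  have key := divE_comb hg1 hψ hP hZ
  refine key.trans ?_
  have hZt : trE ((𝒜 x).comp B + A'.flip (B x)) = τ1 + τ2 := by
    rw [trE_add, hτ1, hτ2, hy, add_comm]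
  rw [← hLf, hZt]
  simp only [Pi.mul_apply]
  simp only [_root_.add_apply, _root_.smul_apply, smul_eq_mul, innerSL_apply_apply, ← hy, ← hz]
  have r1 : ⟪y, 𝒜 x (η x)⟫ = ⟪z, η x⟫ := by rw [← h.symm, ← hz]
  have r2 : ⟪y, z⟫ = ⟪z, y⟫ := real_inner_comm _ _
  have r4 : ⟪η x, z⟫ = ⟪z, η x⟫ := real_inner_comm _ _
  simp only [r1, r2, r4]
  ring

end CarlemanDiv

section CarlemanWeights
open scoped RealInnerProductSpace NNReal Topology

/-- The distance function associated with `B`. -/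
def sigB {d : ℕ} (B : EucSp d →L[ℝ] EucSp d) (x : EucSp d) : ℝ := Real.sqrt ⟪B x, x⟫

/-- The weight in terms of `sigB`. -/
def wtB {d : ℕ} (B : EucSp d →L[ℝ] EucSp d) (ρ μ : ℝ) (x : EucSp d) : ℝ := phiW μ (sigB B x / ρ)

theorem wt_eq {d : ℕ} (A : EucSp d → Matrix (Fin d) (Fin d) ℝ) {ρ : ℝ} (hρ : 0 < ρ) (μ : ℝ) :
    wWeight A ρ μ = wtB (Matrix.toEuclideanCLM (𝕜 := ℝ) (A 0)⁻¹) ρ μ := by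
  funext x
  unfold wWeight wtB sigB
  rw [sigma_eq, map_smul, inner_smul_left, inner_smul_right]
  congr 1
  simp only [conj_trivial]
  rw [← mul_assoc, ← sq, Real.sqrt_mul (by positivity), Real.sqrt_sq (by positivity)]
  field_simp

section
variable {d : ℕ} {s L : ℝ} {𝒜 : EucSp d → EucSp d →L[ℝ] EucSp d} {B : EucSp d →L[ℝ] EucSp d}

theorem sigB_pos (h : CSet d s L 𝒜 B) {x : EucSp d} (hx : x ≠ 0) : 0 < sigB B x :=
  Real.sqrt_pos.2 (h.sigma_pos hx)

theorem sigB_sq (h : CSet d s L 𝒜 B) (x : EucSp d) : sigB B x ^ 2 = ⟪B x, x⟫ :=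
  Real.sq_sqrt (h.sigma_nonneg x)

theorem sigB_le (h : CSet d s L 𝒜 B) (x : EucSp d) : sigB B x ≤ s * ‖x‖ := by
  have hs := h.hs
  apply Real.sqrt_le_iff.2
  refine ⟨by positivity, ?_⟩
  rw [mul_pow]; exact h.sigma_le x

theorem sigB_contDiffAt (h : CSet d s L 𝒜 B) {x : EucSp d} (hx : x ≠ 0) :
    ContDiffAt ℝ (⊤ : ℕ∞) (sigB B) x := by
  unfold sigB
  apply ContDiffAt.sqrt
  · exact (B.contDiff.contDiffAt).inner ℝ contDiffAt_id
  · exact (h.sigma_pos hx).ne'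

theorem sigB_hasFDerivAt (h : CSet d s L 𝒜 B) {x : EucSp d} (hx : x ≠ 0) :
    HasFDerivAt (sigB B) ((1 / sigB B x) • innerSL ℝ (B x)) x := by
  have h1 := ((B.hasFDerivAt (x := x)).inner ℝ (hasFDerivAt_id x)).sqrt (h.sigma_pos hx).ne'
  refine h1.congr_fderiv ?_
  ext v
  simp only [_root_.smul_apply, fderivInnerCLM_apply, ContinuousLinearMap.comp_apply,
    ContinuousLinearMap.prod_apply, innerSL_apply_apply, smul_eq_mul, id,
    ContinuousLinearMap.id_apply]
  rw [h.symmB v x, real_inner_comm v (B x)]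
  unfold sigB
  field_simp
  ring

theorem sig_comp (h : CSet d s L 𝒜 B) {x : EucSp d} (hx : x ≠ 0) {g : ℝ → ℝ} {g' : ℝ}
    (hg : HasDerivAt g g' (sigB B x)) :
    HasFDerivAt (fun x => g (sigB B x)) ((g' / sigB B x) • innerSL ℝ (B x)) x := by
  refine (hg.comp_hasFDerivAt x (sigB_hasFDerivAt h hx)).congr_fderiv ?_
  rw [smul_smul]; congr 1; ring

theorem wtB_pos (h : CSet d s L 𝒜 B) {x : EucSp d} (hx : x ≠ 0) {ρ : ℝ} (hρ : 0 < ρ) (μ : ℝ) :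
    0 < wtB B ρ μ x := phi_pos μ (div_pos (sigB_pos h hx) hρ)

theorem wtB_contDiffAt (h : CSet d s L 𝒜 B) {x : EucSp d} (hx : x ≠ 0) {ρ μ : ℝ} (hρ : 0 < ρ)
    (hμ : 0 < μ) : ContDiffAt ℝ (⊤ : ℕ∞) (wtB B ρ μ) x := by
  unfold wtB
  have h1 := phi_contDiffAt hμ (div_pos (sigB_pos h hx) hρ)
  exact h1.comp x ((sigB_contDiffAt h hx).div_const ρ)

theorem wtB_rpow_contDiffAt (h : CSet d s L 𝒜 B) {x : EucSp d} (hx : x ≠ 0) {ρ μ : ℝ} (hρ : 0 < ρ)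
    (hμ : 0 < μ) (α : ℝ) : ContDiffAt ℝ (⊤ : ℕ∞) (fun x => wtB B ρ μ x ^ α) x :=
  (wtB_contDiffAt h hx hρ hμ).rpow_const_of_ne (wtB_pos h hx hρ μ).ne'

theorem wtB_rpow_hasFDerivAt (h : CSet d s L 𝒜 B) {x : EucSp d} (hx : x ≠ 0) {ρ μ m : ℝ}
    (hρ : 0 < ρ) (hμ : 0 < μ) (hm : m = μ / ρ) (α : ℝ) :
    HasFDerivAt (fun x => wtB B ρ μ x ^ α)
      ((wtB B ρ μ x ^ α * (α * (Real.exp (-(m * sigB B x)) / sigB B x ^ 2))) •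
        innerSL ℝ (B x)) x := by
  have hσ := sigB_pos h hx
  have hr := div_pos hσ hρ
  have hw := phi_pos μ hr
  have h1 := (phi_hasDerivAt hμ hr).comp (sigB B x) ((hasDerivAt_id (sigB B x)).div_const ρ)
  have h2 := h1.rpow_const (p := α) (Or.inl hw.ne')
  have h3 := sig_comp h hx h2
  refine h3.congr_fderiv ?_
  congr 1
  simp only [Function.comp, id, wtB]
  rw [Real.rpow_sub_one hw.ne']
  have e : μ * (sigB B x / ρ) = m * sigB B x := by rw [hm]; ring
  rw [e]
  field_simp

theorem exp_hasFDerivAt (h : CSet d s L 𝒜 B) {x : EucSp d} (hx : x ≠ 0) (m : ℝ) :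
    HasFDerivAt (fun x => (Real.exp (-(m * sigB B x)))⁻¹)
      (((Real.exp (-(m * sigB B x)))⁻¹ * (m / sigB B x)) • innerSL ℝ (B x)) x := by
  have h1 := ((hasDerivAt_id (sigB B x)).const_mul m).exp
  have h2 := sig_comp h hx h1
  simp only [Real.exp_neg, inv_inv]
  refine h2.congr_fderiv ?_
  congr 1
  simp only [id]
  ring

theorem expdiv_hasFDerivAt (h : CSet d s L 𝒜 B) {x : EucSp d} (hx : x ≠ 0) (m c : ℝ) (k : ℕ) :
    HasFDerivAt (fun x => c * (Real.exp (-(m * sigB B x)) / sigB B x ^ k))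
      ((-(c * (Real.exp (-(m * sigB B x)) / sigB B x ^ k)) * (m / sigB B x + k / sigB B x ^ 2)) •
        innerSL ℝ (B x)) x := by
  have hσ := sigB_pos h hx
  have h1 := ((hasDerivAt_id (sigB B x)).const_mul m).neg.exp
  have h2 := (hasDerivAt_id (sigB B x)).pow k
  have h3 := (h1.div h2 (by simp only [id, Pi.pow_apply]; positivity)).const_mul c
  have h4 := sig_comp h hx h3
  refine h4.congr_fderiv ?_
  congr 1
  simp only [id, Pi.pow_apply, Pi.neg_apply]
  rcases k with _ | k
  · simp; ring
  · simp only [Nat.add_sub_cancel]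
    field_simp
    ring

end

theorem grad_contDiff {d : ℕ} {f : EucSp d → ℝ} (hf : ContDiff ℝ (⊤ : ℕ∞) f) :
    ContDiff ℝ (⊤ : ℕ∞) (gradient f) := by
  unfold gradient
  apply (InnerProductSpace.toDual ℝ (EucSp d)).symm.contDiff.comp
  exact hf.fderiv_right (by norm_cast)

theorem grad_inner {d : ℕ} (f : EucSp d → ℝ) (x : EucSp d) :
    innerSL ℝ (gradient f x) = fderiv ℝ f x := by
  ext v
  rw [innerSL_apply_apply, inner_gradient_left]

theorem grad_zero {d : ℕ} {f : EucSp d → ℝ} {x : EucSp d} (hx : x ∉ tsupport f) :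
    gradient f x = 0 := by
  have : fderiv ℝ f x = 0 := by
    by_contra hc
    exact hx (support_fderiv_subset ℝ hc)
  simp [gradient, this]

theorem grad_symm {d : ℕ} {f : EucSp d → ℝ} (hf : ContDiff ℝ (⊤ : ℕ∞) f) (x u v : EucSp d) :
    ⟪fderiv ℝ (gradient f) x u, v⟫ = ⟪u, fderiv ℝ (gradient f) x v⟫ := by
  have hs : IsSymmSndFDerivAt ℝ f x :=
    hf.contDiffAt.isSymmSndFDerivAt (by simp; norm_cast)
  have hd : DifferentiableAt ℝ (fderiv ℝ f) x :=
    (hf.fderiv_right (m := 1) (by norm_cast)).differentiable one_ne_zero |>.differentiableAt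
  have hg : DifferentiableAt ℝ (gradient f) x :=
    (grad_contDiff hf).differentiable (by simp) |>.differentiableAt
  have key : ∀ u v, ⟪fderiv ℝ (gradient f) x u, v⟫ = fderiv ℝ (fderiv ℝ f) x u v := by
    intro u v
    have h1 := hg.hasFDerivAt.inner ℝ (hasFDerivAt_const v x)
    have h2 := hd.hasFDerivAt.clm_apply (hasFDerivAt_const v x)
    have e : (fun t => ⟪gradient f t, v⟫) = fun t => fderiv ℝ f t v := by
      funext t; exact inner_gradient_left
    rw [e] at h1
    have := congrArg (fun T => T u) (h1.unique h2)
    simpa using this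
  rw [key, real_inner_comm _ u, key]
  exact hs u v

end CarlemanWeights

section CarlemanKey
open scoped RealInnerProductSpace NNReal Topology

variable {d : ℕ} {s L : ℝ} {𝒜 : EucSp d → EucSp d →L[ℝ] EucSp d} {B : EucSp d →L[ℝ] EucSp d}

/-- The conjugated function `f = w^{-α} v`. -/
def fConj {d : ℕ} (B : EucSp d →L[ℝ] EucSp d) (ρ μ α : ℝ) (v : EucSp d → ℝ) (x : EucSp d) : ℝ :=
  wtB B ρ μ x ^ (-α) * v x

theorem fConj_zero {ρ μ α : ℝ} {v : EucSp d → ℝ} {x : EucSp d} (hx : x ∉ tsupport v) :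
    fConj B ρ μ α v x = 0 := by
  rw [fConj, image_eq_zero_of_notMem_tsupport hx, mul_zero]

theorem fConj_tsupport {ρ μ α : ℝ} {v : EucSp d → ℝ} :
    tsupport (fConj B ρ μ α v) ⊆ tsupport v := by
  apply closure_minimal _ (isClosed_tsupport v)
  intro x hx
  by_contra hc
  exact hx (fConj_zero hc)

theorem fConj_contDiff (h : CSet d s L 𝒜 B) {ρ μ α : ℝ} (hρ : 0 < ρ) (hμ : 0 < μ)
    {v : EucSp d → ℝ} (hv : ContDiff ℝ (⊤ : ℕ∞) v) (hv0 : ∀ x ∈ tsupport v, x ≠ 0) :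
    ContDiff ℝ (⊤ : ℕ∞) (fConj B ρ μ α v) := by
  rw [contDiff_iff_contDiffAt]
  intro x
  by_cases hx : x ∈ tsupport v
  · exact (wtB_rpow_contDiffAt h (hv0 x hx) hρ hμ (-α)).mul hv.contDiffAt
  · have : fConj B ρ μ α v =ᶠ[𝓝 x] fun _ => 0 := by
      filter_upwards [(isClosed_tsupport v).isOpen_compl.mem_nhds hx] with t ht
      exact fConj_zero ht
    exact contDiffAt_const.congr_of_eventuallyEq this

theorem grad_v (h : CSet d s L 𝒜 B) {ρ μ m α : ℝ} (hρ : 0 < ρ) (hμ : 0 < μ) (hm : m = μ / ρ)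
    {v : EucSp d → ℝ} (hv : ContDiff ℝ (⊤ : ℕ∞) v) (hv0 : ∀ x ∈ tsupport v, x ≠ 0)
    {x : EucSp d} (hx : x ≠ 0) :
    gradient v x = wtB B ρ μ x ^ α • gradient (fConj B ρ μ α v) x
      + (wtB B ρ μ x ^ α * (fConj B ρ μ α v x *
          (α * (Real.exp (-(m * sigB B x)) / sigB B x ^ 2)))) • B x := by
  have h1 := wtB_rpow_hasFDerivAt h hx hρ hμ hm α
  have h2 : HasFDerivAt (fConj B ρ μ α v) (innerSL ℝ (gradient (fConj B ρ μ α v) x)) x := by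
    rw [grad_inner]
    exact ((fConj_contDiff h hρ hμ hv hv0).differentiable (by simp)).differentiableAt.hasFDerivAt
  have h3 := h1.mul h2
  have e : v =ᶠ[𝓝 x] (fun x => wtB B ρ μ x ^ α) * fConj B ρ μ α v := by
    filter_upwards [isOpen_compl_singleton.mem_nhds hx] with t ht
    have hw := wtB_pos h (x := t) ht hρ μ
    simp only [Pi.mul_apply, fConj]
    rw [← mul_assoc, ← Real.rpow_add hw]; simp
  have h4 := h3.congr_of_eventuallyEq e
  apply ext_inner_right ℝ
  intro w
  rw [inner_gradient_left, h4.fderiv]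
  simp only [_root_.add_apply, _root_.smul_apply, smul_eq_mul, innerSL_apply_apply,
    inner_add_left, inner_smul_left, conj_trivial]
  ring

/-- The vector field of the Carleman estimate, as a function of the coefficient matrix. -/
def PsiV {d : ℕ} (B : EucSp d →L[ℝ] EucSp d) (m k α : ℝ) (f : EucSp d → ℝ)
    (q : (EucSp d →L[ℝ] EucSp d) × EucSp d) : EucSp d :=
  ((Real.exp (-(m * sigB B q.2)))⁻¹ * (⟪q.1 (B q.2), gradient f q.2⟫ + k * f q.2)) •
      q.1 (gradient f q.2)
    + ((α ^ 2 / 2) * (Real.exp (-(m * sigB B q.2)) / sigB B q.2 ^ 4)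
        * (⟪q.1 (B q.2), B q.2⟫ * f q.2 ^ 2)
      - (Real.exp (-(m * sigB B q.2)))⁻¹ * (⟪q.1 (gradient f q.2), gradient f q.2⟫ / 2)) •
      q.1 (B q.2)

theorem PsiV_zero {m k α : ℝ} {f : EucSp d → ℝ} {M : EucSp d →L[ℝ] EucSp d} {x : EucSp d}
    (hx : x ∉ tsupport f) : PsiV B m k α f (M, x) = 0 := by
  simp [PsiV, grad_zero hx, image_eq_zero_of_notMem_tsupport hx]

theorem PsiV_contDiff (h : CSet d s L 𝒜 B) {m k α : ℝ} {f : EucSp d → ℝ}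
    (hf : ContDiff ℝ (⊤ : ℕ∞) f) (hf0 : ∀ x ∈ tsupport f, x ≠ 0) :
    ContDiff ℝ 1 (PsiV B m k α f) := by
  rw [contDiff_iff_contDiffAt]
  rintro ⟨M, x⟩
  by_cases hx : x ∈ tsupport f
  · have hx0 := hf0 x hx
    have hσ := sigB_pos h hx0
    have hg : ContDiff ℝ 1 (gradient f) := (grad_contDiff hf).of_le (by norm_cast)
    have hf1 : ContDiff ℝ 1 f := hf.of_le (by norm_cast)
    have hσ1 : ContDiffAt ℝ 1 (sigB B) x :=
      (sigB_contDiffAt h hx0).of_le (by norm_cast)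
    have c2 : ContDiffAt ℝ 1 (fun q : (EucSp d →L[ℝ] EucSp d) × EucSp d => sigB B q.2) (M, x) :=
      ContDiffAt.comp (M, x) (g := sigB B) (f := Prod.snd) hσ1 contDiffAt_snd
    have cg : ContDiffAt ℝ 1 (fun q : (EucSp d →L[ℝ] EucSp d) × EucSp d => gradient f q.2) (M, x) :=
      (hg.comp contDiff_snd).contDiffAt
    have cf : ContDiffAt ℝ 1 (fun q : (EucSp d →L[ℝ] EucSp d) × EucSp d => f q.2) (M, x) :=
      (hf1.comp contDiff_snd).contDiffAt
    have cB : ContDiffAt ℝ 1 (fun q : (EucSp d →L[ℝ] EucSp d) × EucSp d => B q.2) (M, x) :=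
      (B.contDiff.comp contDiff_snd).contDiffAt
    have cM : ContDiffAt ℝ 1 (fun q : (EucSp d →L[ℝ] EucSp d) × EucSp d => q.1) (M, x) :=
      contDiffAt_fst
    have cMg := cM.clm_apply cg
    have cMB := cM.clm_apply cB
    have cE : ContDiffAt ℝ 1 (fun q : (EucSp d →L[ℝ] EucSp d) × EucSp d =>
        Real.exp (-(m * sigB B q.2))) (M, x) := ((contDiffAt_const.mul c2).neg).exp
    have cE1 := cE.inv (Real.exp_pos _).ne'
    have cE2 := cE.div (c2.pow 4) (by positivity)
    unfold PsiV
    exact ((cE1.mul ((cMB.inner ℝ cg).add (contDiffAt_const.mul cf))).smul cMg).add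
      ((((contDiffAt_const.mul cE2).mul ((cMB.inner ℝ cB).mul (cf.pow 2))).sub
        (cE1.mul ((cMg.inner ℝ cg).div_const 2))).smul cMB)
  · have : PsiV B m k α f =ᶠ[𝓝 (M, x)] fun _ => 0 := by
      have ho : IsOpen {q : (EucSp d →L[ℝ] EucSp d) × EucSp d | q.2 ∉ tsupport f} :=
        (isClosed_tsupport f).isOpen_compl.preimage continuous_snd
      filter_upwards [ho.mem_nhds hx] with q hq
      exact PsiV_zero (M := q.1) hq
    exact contDiffAt_const.congr_of_eventuallyEq this

theorem CSet.lipW (h : CSet d s L 𝒜 B) : LipschitzWith L.toNNReal 𝒜 := by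
  apply LipschitzWith.of_dist_le_mul
  intro x y
  rw [dist_eq_norm, dist_eq_norm, Real.coe_toNNReal _ h.hL]
  exact h.lip x y

theorem CSet.opA (h : CSet d s L 𝒜 B) (x : EucSp d) : ‖𝒜 x‖ ≤ s ^ 2 :=
  (𝒜 x).opNorm_le_bound (sq_nonneg _) (h.norm_le x)

theorem lip_V (h : CSet d s L 𝒜 B) {m k α : ℝ} {f : EucSp d → ℝ}
    (hf : ContDiff ℝ (⊤ : ℕ∞) f) (hf0 : ∀ x ∈ tsupport f, x ≠ 0) (hc : HasCompactSupport f) :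
    (∃ C, LipschitzWith C (fun x => PsiV B m k α f (𝒜 x, x))) ∧
      HasCompactSupport (fun x => PsiV B m k α f (𝒜 x, x)) := by
  refine ⟨lip_comp h.lipW h.opA (PsiV_contDiff h hf hf0) hc.isCompact fun M x hx => PsiV_zero hx,
    HasCompactSupport.intro hc.isCompact fun x hx => PsiV_zero hx⟩

theorem lip_X (h : CSet d s L 𝒜 B) {v : EucSp d → ℝ}
    (hv : ContDiff ℝ (⊤ : ℕ∞) v) (hc : HasCompactSupport v) :
    (∃ C, LipschitzWith C (fun x => 𝒜 x (gradient v x))) ∧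
      tsupport (fun x => 𝒜 x (gradient v x)) ⊆ tsupport v := by
  have hg : ContDiff ℝ 1 (gradient v) := (grad_contDiff hv).of_le (by norm_cast)
  have hz : ∀ M : EucSp d →L[ℝ] EucSp d, ∀ x, x ∉ tsupport v → M (gradient v x) = 0 :=
    fun M x hx => by rw [grad_zero hx, map_zero]
  have hΨ : ContDiff ℝ 1 (fun q : (EucSp d →L[ℝ] EucSp d) × EucSp d => q.1 (gradient v q.2)) :=
    contDiff_fst.clm_apply (hg.comp contDiff_snd)
  refine ⟨lip_comp h.lipW h.opA hΨ hc.isCompact hz, ?_⟩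
  apply closure_minimal _ (isClosed_tsupport v)
  intro x hx
  by_contra hcc
  exact hx (hz _ x hcc)

end CarlemanKey

section CarlemanPt
open scoped RealInnerProductSpace NNReal Topology

set_option maxHeartbeats 1000000 in
theorem key_pt {d : ℕ} {s L : ℝ} {𝒜 : EucSp d → EucSp d →L[ℝ] EucSp d}
    {B : EucSp d →L[ℝ] EucSp d} (h : CSet d s L 𝒜 B) (hd : 1 ≤ d)
    {ρ μ m Cm α M1 : ℝ} (hρ : 0 < ρ) (hμ : 0 < μ) (hmρ : m = μ / ρ)
    (hm : m = Cm + 33 * d * L * s ^ 11) (hCm : 0 < Cm) (hα : 0 < α) (hM1 : 1 ≤ M1)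
    (hM : ∀ r, 0 < r → r ≤ s → r ≤ M1 * phiW μ r)
    (hαc : ∀ σ, 0 < σ → σ ≤ s * ρ →
      1.5 * m * σ ≤ α * Real.exp (-(m * σ)) ∧
      139 * m ^ 2 * s ^ 16 * σ ≤ α * Cm * Real.exp (-(m * σ)) ∧
      5 * m * ((d:ℝ) - 2) ^ 2 * s ^ 8 ≤ α ^ 2 * Cm * Real.exp (-(m * σ)) ^ 2)
    {v : EucSp d → ℝ} (hv : ContDiff ℝ (⊤ : ℕ∞) v)
    (hvs : tsupport v ⊆ Metric.ball (0 : EucSp d) ρ \ {0})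
    {x : EucSp d} (hA : DifferentiableAt ℝ 𝒜 x) :
    α * ρ ^ 2 * wtB B ρ μ x ^ (1 - 2 * α) * ⟪𝒜 x (gradient v x), gradient v x⟫
      + α ^ 3 * wtB B ρ μ x ^ (-1 - 2 * α) * v x ^ 2
    ≤ (2 * s ^ 12 * Real.exp (μ * s) ^ 3 * M1 ^ 3 / (Cm * ρ)) * ρ ^ 4
        * (wtB B ρ μ x ^ (2 - 2 * α) * divE (fun x => 𝒜 x (gradient v x)) x ^ 2)
      - (1.5 * s ^ 12 * Real.exp (μ * s) * M1 * ρ / Cm)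
        * (4 * α * divE (fun x => PsiV B m (((d:ℝ) - 2) / 2) α (fConj B ρ μ α v) (𝒜 x, x)) x)
        / 0.9 := by
  have hs := h.hs
  have hs0 : 0 < s := by linarith
  set f := fConj B ρ μ α v with hfdef
  have hv0 : ∀ x ∈ tsupport v, x ≠ 0 := fun x hx => (hvs hx).2
  have hf : ContDiff ℝ (⊤ : ℕ∞) f := fConj_contDiff h hρ hμ hv hv0
  by_cases hx : x ∈ tsupport v
  swap
  · have hxf : x ∉ tsupport f := fun hc => hx (fConj_tsupport hc)
    have e1 : divE (fun x => PsiV B m (((d:ℝ) - 2) / 2) α f (𝒜 x, x)) x = 0 := by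
      apply divE_zero
      intro hc
      apply hxf
      refine closure_minimal ?_ (isClosed_tsupport f) hc
      intro t ht
      by_contra hcc
      exact ht (PsiV_zero hcc)
    rw [e1, grad_zero hx, image_eq_zero_of_notMem_tsupport hx]
    have hw : 0 ≤ wtB B ρ μ x := by
      unfold wtB phiW
      have : 0 ≤ sigB B x / ρ := div_nonneg (Real.sqrt_nonneg _) hρ.le
      positivity
    have : 0 ≤ wtB B ρ μ x ^ (2 - 2 * α) := Real.rpow_nonneg hw _
    simp
    positivity
  have hx0 := hv0 x hx
  have hxρ : ‖x‖ < ρ := by simpa using (hvs hx).1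
  have hσ := sigB_pos h hx0
  have hσ2 := sigB_sq h x
  have hσle : sigB B x ≤ s * ρ := (sigB_le h x).trans (by gcongr)
  have hW := wtB_pos h hx0 hρ μ
  have hAd := hA.hasFDerivAt
  have hA' : ‖fderiv ℝ 𝒜 x‖ ≤ L := by
    have := norm_fderiv_le_of_lipschitz ℝ h.lipW (x₀ := x)
    rwa [Real.coe_toNNReal _ h.hL] at this
  have hηd : HasFDerivAt (gradient f) (fderiv ℝ (gradient f) x) x :=
    ((grad_contDiff hf).differentiable (by simp)).differentiableAt.hasFDerivAt
  have hfd : HasFDerivAt f (innerSL ℝ (gradient f x)) x := by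
    rw [grad_inner]
    exact (hf.differentiable (by simp)).differentiableAt.hasFDerivAt
  obtain ⟨κ, hκ⟩ : ∃ κ : ℝ, κ * s ^ 4 = 1 := ⟨1 / s ^ 4, by field_simp⟩
  obtain ⟨b1, b2, b3, b4, b5, b6, b7, b8, b9, b10, b11⟩ :=
    h.bounds (η := gradient f x) hσ hσ2 hκ hA' rfl rfl rfl
  have hdV := divE_V h (k := ((d:ℝ) - 2) / 2) hAd hηd (grad_symm hf x) hfd
    (exp_hasFDerivAt h hx0 m) (expdiv_hasFDerivAt h hx0 m (α ^ 2 / 2) 4) rfl rfl rfl rfl rfl rfl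
  have hdP := divE_P h hAd hηd hfd (wtB_rpow_hasFDerivAt h hx0 hρ hμ hmρ α)
    (expdiv_hasFDerivAt h hx0 m α 2) rfl rfl rfl rfl rfl
  have hXe : divE (fun x => 𝒜 x (gradient v x)) x = divE (fun x =>
      wtB B ρ μ x ^ α • 𝒜 x (gradient f x) + (wtB B ρ μ x ^ α * (f x *
        (α * (Real.exp (-(m * sigB B x)) / sigB B x ^ 2)))) • 𝒜 x (B x)) x := by
    unfold divE
    congr 1
    apply Filter.EventuallyEq.fderiv_eq
    filter_upwards [isOpen_compl_singleton.mem_nhds hx0] with t ht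
    rw [grad_v h hρ hμ hmρ hv hv0 (α := α) ht, map_add, map_smul, map_smul]
  have hgv := grad_v h hρ hμ hmρ hv hv0 (α := α) hx0
  have hvf : v x = wtB B ρ μ x ^ α * f x := by
    rw [hfdef, fConj, ← mul_assoc, ← Real.rpow_add hW]; simp
  set y := B x with hy
  set z := 𝒜 x y with hz
  set η := gradient f x with hη
  set p := 𝒜 x η with hp
  set σ := sigB B x with hσdef
  set F := Real.exp (-(m * σ)) with hF
  set W := wtB B ρ μ x with hWdef
  set Lf := trE ((𝒜 x).comp (fderiv ℝ (gradient f) x) + (fderiv ℝ 𝒜 x).flip η) with hLf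
  set τ1 := trE ((fderiv ℝ 𝒜 x).flip y) with hτ1
  set τ2 := trE ((𝒜 x).comp B) with hτ2
  have hF0 : 0 < F := Real.exp_pos _
  have hm0 : 0 < m := by rw [hmρ]; positivity
  have hF1 : F ≤ 1 := by
    rw [hF, Real.exp_le_one_iff]; have := mul_pos hm0 hσ; linarith
  have hE : 1 ≤ Real.exp (μ * s) * F := by
    rw [hF, ← Real.exp_add, Real.one_le_exp_iff]
    have : m * σ ≤ m * (s * ρ) := by gcongr
    have e : m * (s * ρ) = μ * s := by rw [hmρ]; field_simp
    linarith
  have hE1 : 1 ≤ Real.exp (μ * s) := by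
    rw [Real.one_le_exp_iff]; positivity
  have hW1 : ρ * W ≤ σ := by
    have := phi_le hμ (div_pos hσ hρ).le
    rw [le_div_iff₀ hρ] at this
    rw [mul_comm]; exact this
  have hW2 : σ ≤ M1 * (ρ * W) := by
    have := hM (σ / ρ) (div_pos hσ hρ) (by rw [div_le_iff₀ hρ]; exact hσle)
    rw [div_le_iff₀ hρ] at this
    calc σ ≤ M1 * phiW μ (σ / ρ) * ρ := this
      _ = M1 * (ρ * W) := by rw [hWdef, wtB]; ring
  obtain ⟨a1, a2, a3⟩ := hαc σ hσ hσle
  have hr : ⟪p, y⟫ = ⟪z, η⟫ := by rw [hp, h.symm, ← hz, real_inner_comm]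
  have hcs : 2 * (α * f x * (F / σ ^ 2)) * ⟪z, η⟫
      ≤ ⟪p, η⟫ + (α * f x * (F / σ ^ 2)) ^ 2 * ⟪z, y⟫ := by
    generalize α * f x * (F / σ ^ 2) = c
    have h1 := h.nonneg x (η - c • y)
    simp only [map_sub, map_smul, inner_sub_left, inner_sub_right, inner_smul_left,
      inner_smul_right, conj_trivial, ← hz, ← hp, hr] at h1
    linarith
  obtain ⟨P, hP⟩ : ∃ P, P = Lf + α ^ 2 * (F ^ 2 / σ ^ 4) * ⟪z, y⟫ * f x
    + 2 * α * (F / σ ^ 2) * ⟪z, η⟫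
    + α * f x * (F / σ ^ 2) * (τ1 + τ2 - ⟪z, y⟫ * (m / σ + 2 / σ ^ 2)) := ⟨_, rfl⟩
  have hdV2 : divE (fun x => PsiV B m (((d:ℝ) - 2) / 2) α f (𝒜 x, x)) x = _ := hdV
  have main := scal_main (n := d) (dV := divE (fun x => PsiV B m (((d:ℝ) - 2) / 2) α f (𝒜 x, x)) x)
    (P := P) (by exact_mod_cast hd) h.hL hs hm hCm hσ b1 hF0 hα hκ b2 b3 b4 b5 b6
    b7 b8 b9 b10 b11 a1 a2 a3 (f := f x) (Lf := Lf) (b0 := ⟪z, η⟫) (by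
      rw [hdV2]; push_cast; ring) hP
  have fin := scal_fin hs hCm hσ b1 hF0 hF1 hα hκ b3 hρ hW hW1 hW2 hM1 hE hE1 hcs main
  have hXP : divE (fun x => 𝒜 x (gradient v x)) x = W ^ α * P := by
    rw [hXe, hdP, hP]; push_cast; ring
  have hform : ⟪𝒜 x (gradient v x), gradient v x⟫ = (W ^ α) ^ 2 *
      (⟪p, η⟫ + 2 * (α * f x * (F / σ ^ 2)) * ⟪z, η⟫
        + (α * f x * (F / σ ^ 2)) ^ 2 * ⟪z, y⟫) := by
    rw [hgv]
    simp only [map_add, map_smul, inner_add_left, inner_add_right, inner_smul_left,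
      inner_smul_right, conj_trivial, ← hz, ← hp, hr]
    ring
  have r0 : (W ^ α) ^ 2 = W ^ (2 * α) := by
    rw [← Real.rpow_natCast, ← Real.rpow_mul hW.le]; congr 1; push_cast; ring
  have r1 : W ^ (1 - 2 * α) * (W ^ α) ^ 2 = W := by
    rw [r0, ← Real.rpow_add hW]; simp
  have r2 : W ^ (-1 - 2 * α) * (W ^ α) ^ 2 = W⁻¹ := by
    rw [r0, ← Real.rpow_add hW]; simp [Real.rpow_neg_one]
  have r3 : W ^ (2 - 2 * α) * (W ^ α) ^ 2 = W ^ 2 := by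
    rw [r0, ← Real.rpow_add hW]; simp
  rw [hform, hXP, hvf]
  have l1 : α * ρ ^ 2 * W ^ (1 - 2 * α) * ((W ^ α) ^ 2 *
      (⟪p, η⟫ + 2 * (α * f x * (F / σ ^ 2)) * ⟪z, η⟫
        + (α * f x * (F / σ ^ 2)) ^ 2 * ⟪z, y⟫)) + α ^ 3 * W ^ (-1 - 2 * α) * (W ^ α * f x) ^ 2
      = α * ρ ^ 2 * W * (⟪p, η⟫ + 2 * (α * f x * (F / σ ^ 2)) * ⟪z, η⟫
        + (α * f x * (F / σ ^ 2)) ^ 2 * ⟪z, y⟫) + α ^ 3 * W⁻¹ * f x ^ 2 := by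
    linear_combination (α * ρ ^ 2 * (⟪p, η⟫ + 2 * (α * f x * (F / σ ^ 2)) * ⟪z, η⟫
        + (α * f x * (F / σ ^ 2)) ^ 2 * ⟪z, y⟫)) * r1 + (α ^ 3 * f x ^ 2) * r2
  have l2 : W ^ (2 - 2 * α) * (W ^ α * P) ^ 2 = W ^ 2 * P ^ 2 := by
    rw [← r3]; ring
  rw [l1, l2]
  exact fin

end CarlemanPt

theorem alpha_ok {n L s ρ μ Cμ α E M1 σ F : ℝ} (hn : 1 ≤ n) (hL : 0 ≤ L) (hs : 1 ≤ s) (hρ : 0 < ρ)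
    (hμ : 0 < μ) (hC : 0 < Cμ) (hE : 1 + μ ≤ E) (hM1 : 1 ≤ M1) (hM : 64 * μ ≤ M1 ^ 6 ∨ M1 = E)
    (hα : 11 * n ^ 4 * s ^ 33 * E ^ 6 * M1 ^ 6 * (3 * ρ * L + μ + 1) ^ 2
      * (1 + μ * (μ + 1) / Cμ) ≤ α) (hσ : 0 < σ) (hσ2 : σ ≤ s * ρ) (hF : 0 < F)
    (hEF : 1 ≤ E * F) :
    0 < α ∧ 1.5 * (μ / ρ) * σ ≤ α * F ∧
    139 * (μ / ρ) ^ 2 * s ^ 16 * σ ≤ α * (Cμ / ρ) * F ∧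
    5 * (μ / ρ) * (n - 2) ^ 2 * s ^ 8 ≤ α ^ 2 * (Cμ / ρ) * F ^ 2 := by
  have hE1 : 1 ≤ E := by linarith
  have hs0 : 0 < s := by linarith
  have hn0 : 0 < n := by linarith
  have hE0 : 0 < E := by linarith
  have hM0 : 0 < M1 := by linarith
  have hq : (μ + 1) ^ 2 ≤ (3 * ρ * L + μ + 1) ^ 2 := by
    have : 0 ≤ 3 * ρ * L := by positivity
    gcongr; linarith
  obtain ⟨T, hT⟩ : ∃ T, T = n ^ 4 * s ^ 33 * E ^ 6 * M1 ^ 6 * (μ + 1) ^ 2 := ⟨_, rfl⟩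
  have hT0 : 0 < T := by rw [hT]; positivity
  have hα0 : 11 * T * (1 + μ * (μ + 1) / Cμ) ≤ α := by
    refine le_trans ?_ hα
    have : 0 ≤ μ * (μ + 1) / Cμ := by positivity
    have h2 : 11 * T ≤ 11 * n ^ 4 * s ^ 33 * E ^ 6 * M1 ^ 6 * (3 * ρ * L + μ + 1) ^ 2 := by
      rw [hT]
      calc _ = 11 * n ^ 4 * s ^ 33 * E ^ 6 * M1 ^ 6 * (μ + 1) ^ 2 := by ring
        _ ≤ _ := by gcongr
    gcongr
  have hα1 : 11 * T ≤ α := by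
    refine le_trans ?_ hα0
    have : 0 ≤ μ * (μ + 1) / Cμ := by positivity
    nlinarith
  have hα2 : 11 * T * (μ * (μ + 1)) ≤ α * Cμ := by
    calc _ ≤ 11 * T * (Cμ + μ * (μ + 1)) := by gcongr; linarith
      _ = 11 * T * (1 + μ * (μ + 1) / Cμ) * Cμ := by field_simp
      _ ≤ _ := by gcongr
  have hαp : 0 < α := by linarith
  have hTF : n ^ 4 * s ^ 33 * E ^ 5 * M1 ^ 6 * (μ + 1) ^ 2 ≤ T * F := by
    calc _ = n ^ 4 * s ^ 33 * E ^ 5 * M1 ^ 6 * (μ + 1) ^ 2 * 1 := by ring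
      _ ≤ n ^ 4 * s ^ 33 * E ^ 5 * M1 ^ 6 * (μ + 1) ^ 2 * (E * F) := by gcongr
      _ = T * F := by rw [hT]; ring
  have p1 : 1 ≤ n ^ 4 := one_le_pow₀ hn
  have p2 : 1 ≤ E ^ 5 := one_le_pow₀ hE1
  have p3 : 1 ≤ M1 ^ 6 := one_le_pow₀ hM1
  have p4 : s ≤ s ^ 33 := le_self_pow₀ hs (by norm_num)
  refine ⟨hαp, ?_, ?_, ?_⟩
  · calc 1.5 * (μ / ρ) * σ ≤ 1.5 * (μ / ρ) * (s * ρ) := by gcongr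
      _ = 1.5 * (s * μ) := by field_simp
      _ ≤ 11 * (1 * s * 1 * 1 * (μ + 1) ^ 2) := by nlinarith [mul_pos hs0 hμ, mul_pos (mul_pos hs0 hμ) hμ]
      _ ≤ 11 * (n ^ 4 * s ^ 33 * E ^ 5 * M1 ^ 6 * (μ + 1) ^ 2) := by gcongr
      _ ≤ 11 * (T * F) := by gcongr
      _ = 11 * T * F := by ring
      _ ≤ α * F := by gcongr
  · have key : 139 * μ ≤ 11 * (E ^ 5 * M1 ^ 6 * (μ + 1) ^ 3) := by
      have q3 : 1 ≤ (μ + 1) ^ 3 := one_le_pow₀ (by linarith)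
      rcases hM with h64 | hME
      · calc 139 * μ ≤ 11 * (1 * (64 * μ) * 1) := by linarith
          _ ≤ _ := by gcongr
      · have hb : 1 + (14:ℕ) * μ ≤ (1 + μ) ^ 14 := one_add_mul_le_pow (by linarith) 14
        push_cast at hb
        calc 139 * μ ≤ 11 * (1 + μ) ^ 14 := by linarith
          _ = 11 * ((1 + μ) ^ 5 * (1 + μ) ^ 6 * (μ + 1) ^ 3) := by ring
          _ ≤ _ := by rw [hME]; gcongr
    have p5 : s ^ 17 ≤ s ^ 33 := pow_le_pow_right₀ hs (by norm_num)
    calc 139 * (μ / ρ) ^ 2 * s ^ 16 * σ ≤ 139 * (μ / ρ) ^ 2 * s ^ 16 * (s * ρ) := by gcongr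
      _ = (1 * s ^ 17 * (139 * μ) * μ) / ρ := by field_simp
      _ ≤ (n ^ 4 * s ^ 33 * (11 * (E ^ 5 * M1 ^ 6 * (μ + 1) ^ 3)) * μ) / ρ := by gcongr
      _ = (11 * (n ^ 4 * s ^ 33 * E ^ 5 * M1 ^ 6 * (μ + 1) ^ 2) * (μ * (μ + 1))) / ρ := by ring
      _ ≤ (11 * (T * F) * (μ * (μ + 1))) / ρ := by gcongr
      _ = (11 * T * (μ * (μ + 1))) * F / ρ := by ring
      _ ≤ (α * Cμ) * F / ρ := by gcongr
      _ = _ := by ring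
  · have hn2 : (n - 2) ^ 2 ≤ n ^ 4 := by nlinarith [sq_nonneg (n-2), mul_pos hn0 hn0]
    have hone : 1 ≤ T * F := by
      refine le_trans ?_ hTF
      calc (1:ℝ) = 1 * 1 * 1 * 1 * 1 := by ring
        _ ≤ _ := by
          gcongr
          · linarith
          · exact one_le_pow₀ (by linarith)
    have h8 : s ^ 8 ≤ s ^ 33 := pow_le_pow_right₀ hs (by norm_num)
    have hbig : n ^ 4 * s ^ 8 ≤ T * F := by
      refine le_trans ?_ hTF
      calc n ^ 4 * s ^ 8 = n ^ 4 * s ^ 8 * 1 * 1 * 1 := by ring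
        _ ≤ _ := by
          gcongr
          exact one_le_pow₀ (by linarith)
    calc 5 * (μ / ρ) * (n - 2) ^ 2 * s ^ 8 = 5 * ((n - 2) ^ 2 * s ^ 8) * μ / ρ := by ring
      _ ≤ 5 * (n ^ 4 * s ^ 8) * μ / ρ := by gcongr
      _ ≤ 121 * (T * F) * (μ * 1) / ρ := by
        gcongr ?_ / ρ
        have := mul_le_mul_of_nonneg_right hbig hμ.le
        have h0 : 0 ≤ T * F * μ := by positivity
        linarith
      _ ≤ 121 * (T * F) * (μ * (μ + 1)) / ρ := by gcongr; linarith
      _ = 121 * (T * F) * 1 * (μ * (μ + 1)) / ρ := by ring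
      _ ≤ 121 * (T * F) * (T * F) * (μ * (μ + 1)) / ρ := by gcongr
      _ = (11 * T) * (11 * T * (μ * (μ + 1))) * F ^ 2 / ρ := by ring
      _ ≤ α * (α * Cμ) * F ^ 2 / ρ := by gcongr
      _ = _ := by ring

theorem mu1_alt {μ θE : ℝ} (hμ : 0 < μ) (hθE : 1 ≤ θE) :
    64 * μ ≤ mu1Of θE μ ^ 6 ∨ mu1Of θE μ = Real.exp (μ * Real.sqrt θE) := by
  unfold mu1Of
  split_ifs with h
  · right; rfl
  · left
    push Not at h
    have hs : 1 ≤ Real.sqrt θE := by rw [Real.one_le_sqrt]; exact hθE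
    have h2 : μ ≤ μ * Real.sqrt θE := le_mul_of_one_le_right hμ.le hs
    set X := μ * Real.sqrt θE
    have he : (2:ℝ) ≤ Real.exp 1 := by have := Real.add_one_le_exp (1:ℝ); linarith
    calc 64 * μ ≤ 64 * X := by gcongr
      _ ≤ 64 * X ^ 6 := by gcongr; exact le_self_pow₀ h.le (by norm_num)
      _ = 2 ^ 6 * X ^ 6 := by norm_num
      _ ≤ Real.exp 1 ^ 6 * X ^ 6 := by gcongr
      _ = _ := by ring

section CarlemanFinal
open scoped RealInnerProductSpace NNReal Topology

theorem wtB_nonneg {d : ℕ} (B : EucSp d →L[ℝ] EucSp d) {ρ : ℝ} (hρ : 0 < ρ) (μ : ℝ) (x : EucSp d) :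
    0 ≤ wtB B ρ μ x := by
  unfold wtB phiW sigB
  positivity

theorem R_integrable {d : ℕ} {s L : ℝ} {𝒜 : EucSp d → EucSp d →L[ℝ] EucSp d}
    {B : EucSp d →L[ℝ] EucSp d} (h : CSet d s L 𝒜 B) {ρ μ : ℝ} (hρ : 0 < ρ) (hμ : 0 < μ)
    (β : ℝ) {v : EucSp d → ℝ} (hv : ContDiff ℝ (⊤ : ℕ∞) v) (hc : HasCompactSupport v)
    (hv0 : ∀ x ∈ tsupport v, x ≠ 0) :
    Integrable (fun x => wtB B ρ μ x ^ β * divE (fun x => 𝒜 x (gradient v x)) x ^ 2) := by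
  obtain ⟨⟨C, hX⟩, hXs⟩ := lip_X h hv hc
  rw [← integrableOn_iff_integrable_of_support_subset (s := tsupport v)]
  · apply IntegrableOn.continuousOn_mul _ _ hc.isCompact
    · intro x hx
      exact (wtB_rpow_contDiffAt h (hv0 x hx) hρ hμ β).continuousAt.continuousWithinAt
    · refine Measure.integrableOn_of_bounded (M := (d * C) ^ 2) (hc.isCompact.measure_lt_top.ne)
        ((divE_measurable _).pow_const 2).aestronglyMeasurable (ae_of_all _ fun x => ?_)
      rw [Real.norm_eq_abs, abs_pow]
      have := divE_bound hX x
      gcongr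
  · intro x hx
    by_contra hcc
    apply hx
    simp [divE_zero (fun hh => hcc (hXs hh))]

theorem D_zero {d : ℕ} {s L : ℝ} {𝒜 : EucSp d → EucSp d →L[ℝ] EucSp d}
    {B : EucSp d →L[ℝ] EucSp d} (h : CSet d s L 𝒜 B) {ρ μ : ℝ} (hρ : 0 < ρ) (hμ : 0 < μ)
    (m k α : ℝ) {v : EucSp d → ℝ} (hv : ContDiff ℝ (⊤ : ℕ∞) v) (hc : HasCompactSupport v)
    (hv0 : ∀ x ∈ tsupport v, x ≠ 0) :
    Integrable (fun x => divE (fun x => PsiV B m k α (fConj B ρ μ α v) (𝒜 x, x)) x) ∧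
    ∫ x, divE (fun x => PsiV B m k α (fConj B ρ μ α v) (𝒜 x, x)) x = 0 := by
  have hsub : tsupport (fConj B ρ μ α v) ⊆ tsupport v := fConj_tsupport
  have hfc : HasCompactSupport (fConj B ρ μ α v) :=
    hc.isCompact.of_isClosed_subset (isClosed_tsupport _) hsub
  obtain ⟨⟨C, hX⟩, hXc⟩ := lip_V h (m := m) (k := k) (α := α)
    (fConj_contDiff h hρ hμ hv hv0) (fun x hx => hv0 x (hsub hx)) hfc
  exact ⟨divE_integrable hX hXc, divE_integral hX hXc⟩

theorem abstract_int {d : ℕ} {f R1 R2 D1 D2 : EucSp d → ℝ} {K K2 K' : ℝ} (hf : ∀ x, 0 ≤ f x)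
    (hR1 : Integrable R1) (hR2 : Integrable R2) (hD1 : Integrable D1) (hD2 : Integrable D2)
    (hd1 : ∫ x, D1 x = 0) (hd2 : ∫ x, D2 x = 0) (h1 : ∀ x, 0 ≤ R1 x) (h2 : ∀ x, 0 ≤ R2 x)
    (hK : K ≤ K') (hle : ∀ᵐ x, f x ≤ K * (R1 x + R2 x) - K2 * (D1 x + D2 x)) :
    ∫ x, f x ≤ K' * ∫ x, (R1 x + R2 x) := by
  have i1 : Integrable (fun x => K * (R1 x + R2 x)) := (hR1.add hR2).const_mul K
  have i2 : Integrable (fun x => K2 * (D1 x + D2 x)) := (hD1.add hD2).const_mul K2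
  calc ∫ x, f x ≤ ∫ x, (K * (R1 x + R2 x) - K2 * (D1 x + D2 x)) :=
        integral_mono_of_nonneg (ae_of_all _ hf) (i1.sub i2) hle
    _ = K * ∫ x, (R1 x + R2 x) := by
        rw [integral_sub i1 i2, integral_const_mul, integral_const_mul,
          integral_add hD1 hD2, hd1, hd2]
        ring
    _ ≤ _ := by
        gcongr
        exact integral_nonneg fun x => add_nonneg (h1 x) (h2 x)

theorem pd_split {d : ℕ} {u : EucSp d → ℂ} {x : EucSp d} (hu : DifferentiableAt ℝ u x) (i : Fin d) :
    pd i u x = ((gradient (fun y => (u y).re) x i : ℝ) : ℂ)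
      + ((gradient (fun y => (u y).im) x i : ℝ) : ℂ) * Complex.I := by
  have hg : ∀ g : EucSp d → ℝ, gradient g x i = fderiv ℝ g x (EuclideanSpace.single i 1) := by
    intro g
    rw [← inner_gradient_left]
    rw [EuclideanSpace.inner_single_right]; simp
  have e1 : fderiv ℝ (fun y => (u y).re) x = Complex.reCLM.comp (fderiv ℝ u x) :=
    (Complex.reCLM.hasFDerivAt.comp x hu.hasFDerivAt).fderiv
  have e2 : fderiv ℝ (fun y => (u y).im) x = Complex.imCLM.comp (fderiv ℝ u x) :=
    (Complex.imCLM.hasFDerivAt.comp x hu.hasFDerivAt).fderiv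
  rw [hg, hg, e1, e2]
  simp only [ContinuousLinearMap.comp_apply, Complex.reCLM_apply, Complex.imCLM_apply, pd]
  exact (Complex.re_add_im _).symm

theorem gradForm_split {d : ℕ} (A : EucSp d → Matrix (Fin d) (Fin d) ℝ) {u : EucSp d → ℂ}
    {x : EucSp d} (hu : DifferentiableAt ℝ u x) :
    gradForm A u x =
      ⟪Matrix.toEuclideanCLM (𝕜 := ℝ) (A x) (gradient (fun y => (u y).re) x),
        gradient (fun y => (u y).re) x⟫ +
      ⟪Matrix.toEuclideanCLM (𝕜 := ℝ) (A x) (gradient (fun y => (u y).im) x),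
        gradient (fun y => (u y).im) x⟫ := by
  rw [real_inner_comm, inner_matrix, real_inner_comm, inner_matrix, gradForm, Complex.re_sum,
    ← Finset.sum_add_distrib]
  refine Finset.sum_congr rfl fun i _ => ?_
  rw [Complex.re_sum, ← Finset.sum_add_distrib]
  refine Finset.sum_congr rfl fun j _ => ?_
  rw [pd_split hu, pd_split hu]
  simp
  ring

theorem div_split {d : ℕ} (A : EucSp d → Matrix (Fin d) (Fin d) ℝ) {u : EucSp d → ℂ}
    (hu : ContDiff ℝ (⊤ : ℕ∞) u) {x : EucSp d}
    (hA : DifferentiableAt ℝ (fun x => Matrix.toEuclideanCLM (𝕜 := ℝ) (A x)) x)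
    (hu1 : ContDiff ℝ (⊤ : ℕ∞) (fun y => (u y).re)) (hu2 : ContDiff ℝ (⊤ : ℕ∞) (fun y => (u y).im)) :
    ‖divAgrad A u x‖ ^ 2 =
      divE (fun x => Matrix.toEuclideanCLM (𝕜 := ℝ) (A x) (gradient (fun y => (u y).re) x)) x ^ 2 +
      divE (fun x => Matrix.toEuclideanCLM (𝕜 := ℝ) (A x) (gradient (fun y => (u y).im) x)) x ^ 2 := by
  set X1 := fun x => Matrix.toEuclideanCLM (𝕜 := ℝ) (A x) (gradient (fun y => (u y).re) x) with hX1
  set X2 := fun x => Matrix.toEuclideanCLM (𝕜 := ℝ) (A x) (gradient (fun y => (u y).im) x) with hX2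
  have hud : Differentiable ℝ u := hu.differentiable (by norm_cast)
  have d1 : DifferentiableAt ℝ X1 x :=
    hA.clm_apply ((grad_contDiff hu1).differentiable (by norm_cast) x)
  have d2 : DifferentiableAt ℝ X2 x :=
    hA.clm_apply ((grad_contDiff hu2).differentiable (by norm_cast) x)
  have key : ∀ i, pd i (fun y => ∑ j, (A y i j : ℂ) * pd j u y) x =
      (((fderiv ℝ X1 x (EuclideanSpace.single i 1)) i : ℝ) : ℂ) +
      (((fderiv ℝ X2 x (EuclideanSpace.single i 1)) i : ℝ) : ℂ) * Complex.I := by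
    intro i
    have hfun : (fun y => ∑ j, (A y i j : ℂ) * pd j u y) =
        fun y => ((X1 y i : ℝ) : ℂ) + ((X2 y i : ℝ) : ℂ) * Complex.I := by
      funext y
      have a1 : ∀ g : EucSp d, (Matrix.toEuclideanCLM (𝕜 := ℝ) (A y) g) i = ∑ j, A y i j * g j := by
        intro g
        simp [Matrix.mulVec, dotProduct]
      simp only [hX1, hX2, a1]
      push_cast
      rw [Finset.sum_mul, ← Finset.sum_add_distrib]
      refine Finset.sum_congr rfl fun j _ => ?_
      rw [pd_split (hud y)]
      ring
    rw [hfun]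
    have c1 : HasFDerivAt (fun y => ((X1 y i : ℝ) : ℂ))
        ((Complex.ofRealCLM.comp (EuclideanSpace.proj i : EucSp d →L[ℝ] ℝ)).comp (fderiv ℝ X1 x)) x :=
      (Complex.ofRealCLM.comp (EuclideanSpace.proj i : EucSp d →L[ℝ] ℝ)).hasFDerivAt.comp x
        d1.hasFDerivAt
    have c2 : HasFDerivAt (fun y => ((X2 y i : ℝ) : ℂ))
        ((Complex.ofRealCLM.comp (EuclideanSpace.proj i : EucSp d →L[ℝ] ℝ)).comp (fderiv ℝ X2 x)) x :=
      (Complex.ofRealCLM.comp (EuclideanSpace.proj i : EucSp d →L[ℝ] ℝ)).hasFDerivAt.comp x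
        d2.hasFDerivAt
    have c3 := c1.add (c2.mul_const Complex.I)
    unfold pd
    have c4 := c3.fderiv
    simp only [Pi.add_def] at c4
    rw [c4]
    simp [mul_comm]
  have : divAgrad A u x = (divE X1 x : ℂ) + (divE X2 x : ℂ) * Complex.I := by
    unfold divAgrad divE trE
    push_cast
    rw [Finset.sum_mul, ← Finset.sum_add_distrib]
    exact Finset.sum_congr rfl fun i _ => key i
  rw [this, Complex.sq_norm, Complex.normSq_add_mul_I]

end CarlemanFinal

/-- **Carleman estimate with explicit constants** in the case `b ≡ 0`, `c ≡ 0`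
(Remark after Theorem 4.5). -/
theorem carleman_estimate_explicit (d : ℕ) (hd : 0 < d) (θE θL : ℝ)
    (hθE : 1 ≤ θE) (hθL : 0 ≤ θL)
    (A : EucSp d → Matrix (Fin d) (Fin d) ℝ)
    (hAs : IsSymmA A univ) (hAe : IsElliptic θE A univ) (hAl : IsLipA θL A univ)
    (ρ μ : ℝ) (hρ : 0 < ρ) (hμ : 33 * d * ρ * θE ^ ((11:ℝ)/2) * θL < μ) :
    ∀ α : ℝ,
      11 * d ^ 4 * θE ^ ((33:ℝ)/2) * Real.exp (6 * μ * Real.sqrt θE) * mu1Of θE μ ^ 6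
          * (3 * ρ * θL + μ + 1) ^ 2
          * (1 + μ * (μ + 1) / (μ - 33 * d * θE ^ ((11:ℝ)/2) * θL * ρ)) ≤ α →
    ∀ u : EucSp d → ℂ, ContDiff ℝ (⊤ : ℕ∞) u → HasCompactSupport u →
      tsupport u ⊆ Metric.ball (0 : EucSp d) ρ \ {0} →
      (∫ x : EucSp d,
          (α * ρ ^ 2 * wWeight A ρ μ x ^ (1 - 2 * α) * gradForm A u x
            + α ^ 3 * wWeight A ρ μ x ^ (-1 - 2 * α) * ‖u x‖ ^ 2)) ≤
        (2 * d ^ 2 * θE ^ 8 * Real.exp (4 * μ * Real.sqrt θE) * mu1Of θE μ ^ 4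
            * (3 * μ ^ 2 + (9 * ρ * θL + 3) * μ + 1)
            / (μ - 33 * d * θE ^ ((11:ℝ)/2) * θL * ρ))
          * ρ ^ 4 * ∫ x : EucSp d, wWeight A ρ μ x ^ (2 - 2 * α) * ‖divAgrad A u x‖ ^ 2 := by
  intro α hα u hu huc hus
  have hs : 1 ≤ √θE := Real.one_le_sqrt.2 hθE
  have hs0 : 0 < √θE := by linarith
  have hp : ∀ k : ℕ, θE ^ ((k:ℝ) / 2) = √θE ^ k := by
    intro k
    rw [Real.sqrt_eq_rpow, ← Real.rpow_natCast, ← Real.rpow_mul (by linarith)]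
    congr 1; ring
  have hp11 : θE ^ ((11:ℝ) / 2) = √θE ^ 11 := by exact_mod_cast hp 11
  have hp33 : θE ^ ((33:ℝ) / 2) = √θE ^ 33 := by exact_mod_cast hp 33
  have hp8 : θE ^ 8 = √θE ^ 16 := by
    rw [show (16:ℕ) = 2 * 8 from rfl, pow_mul, Real.sq_sqrt (by linarith)]
  rw [hp11, hp33] at hα
  rw [hp11] at hμ
  rw [hp11, hp8]
  have hd1 : (1:ℝ) ≤ d := by exact_mod_cast hd
  have hμ0 : 0 < μ := lt_of_le_of_lt (by positivity) hμ
  have h := cset_of hθE hθL hAs hAe hAl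
  rw [wt_eq A hρ μ]
  set s := √θE with hsdef
  set 𝒜 := fun x => Matrix.toEuclideanCLM (𝕜 := ℝ) (A x) with h𝒜
  set B := Matrix.toEuclideanCLM (𝕜 := ℝ) (A 0)⁻¹ with hB
  set M1 := mu1Of θE μ with hM1def
  set Cμ := μ - 33 * d * s ^ 11 * θL * ρ with hCμ
  have hC0 : 0 < Cμ := by rw [hCμ]; linarith
  have hM1 : 1 ≤ M1 := mu1_ge_one hμ0
  have hE6 : Real.exp (6 * μ * s) = Real.exp (μ * s) ^ 6 := by
    rw [← Real.exp_nat_mul]; congr 1; push_cast; ring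
  have hE4 : Real.exp (4 * μ * s) = Real.exp (μ * s) ^ 4 := by
    rw [← Real.exp_nat_mul]; congr 1; push_cast; ring
  rw [hE6] at hα
  rw [hE4]
  have hE : 1 + μ ≤ Real.exp (μ * s) := by
    have := Real.add_one_le_exp (μ * s)
    nlinarith
  have hok : ∀ σ, 0 < σ → σ ≤ s * ρ → _ := fun σ hσ hσ2 =>
    alpha_ok (F := Real.exp (-(μ / ρ * σ))) hd1 hθL hs hρ hμ0 hC0 hE hM1 (mu1_alt hμ0 hθE) hα hσ hσ2
      (Real.exp_pos _) (by
        rw [← Real.exp_add]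
        apply Real.one_le_exp
        have : μ / ρ * σ ≤ μ / ρ * (s * ρ) := by gcongr
        have e : μ / ρ * (s * ρ) = μ * s := by field_simp
        linarith)
  have hα0 : 0 < α := (hok (s * ρ) (by positivity) le_rfl).1
  have hkey := fun (v : EucSp d → ℝ) hv hvs x hA =>
    key_pt (v := v) (x := x) (m := μ / ρ) (Cm := Cμ / ρ) (α := α) h hd hρ hμ0 rfl
      (by rw [hCμ]; field_simp; ring) (by positivity) hα0 hM1
      (fun r hr hr1 => phi_ge hμ0 hr hr1) (fun σ h1 h2 => (hok σ h1 h2).2) hv hvs hA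
  have hu1 : ContDiff ℝ (⊤ : ℕ∞) (fun y => (u y).re) := Complex.reCLM.contDiff.comp hu
  have hu2 : ContDiff ℝ (⊤ : ℕ∞) (fun y => (u y).im) := Complex.imCLM.contDiff.comp hu
  have ht1 : tsupport (fun y => (u y).re) ⊆ tsupport u := tsupport_comp_subset Complex.zero_re u
  have ht2 : tsupport (fun y => (u y).im) ⊆ tsupport u := tsupport_comp_subset Complex.zero_im u
  have hc1 : HasCompactSupport (fun y => (u y).re) := huc.comp_left Complex.zero_re
  have hc2 : HasCompactSupport (fun y => (u y).im) := huc.comp_left Complex.zero_im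
  have hud : Differentiable ℝ u := hu.differentiable (by norm_cast)
  have hz1 : ∀ x ∈ tsupport (fun y => (u y).re), x ≠ 0 := fun x hx => (hus (ht1 hx)).2
  have hz2 : ∀ x ∈ tsupport (fun y => (u y).im), x ≠ 0 := fun x hx => (hus (ht2 hx)).2
  have hae : ∀ᵐ x, DifferentiableAt ℝ 𝒜 x := h.lipW.ae_differentiableAt
  have hr : ∫ x, wtB B ρ μ x ^ (2 - 2 * α) * ‖divAgrad A u x‖ ^ 2 =
      ∫ x, (wtB B ρ μ x ^ (2 - 2 * α) * divE (fun x => 𝒜 x (gradient (fun y => (u y).re) x)) x ^ 2 +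
        wtB B ρ μ x ^ (2 - 2 * α) * divE (fun x => 𝒜 x (gradient (fun y => (u y).im) x)) x ^ 2) := by
    apply integral_congr_ae
    filter_upwards [hae] with x hx
    rw [div_split A hu hx hu1 hu2]
    ring
  rw [hr]
  obtain ⟨iD1, zD1⟩ := D_zero h hρ hμ0 (μ / ρ) (((d:ℝ) - 2) / 2) α hu1 hc1 hz1
  obtain ⟨iD2, zD2⟩ := D_zero h hρ hμ0 (μ / ρ) (((d:ℝ) - 2) / 2) α hu2 hc2 hz2
  have hw : ∀ x β, 0 ≤ wtB B ρ μ x ^ (β : ℝ) := fun x β => Real.rpow_nonneg (wtB_nonneg B hρ μ x) β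
  refine abstract_int (K := (2 * s ^ 12 * Real.exp (μ * s) ^ 3 * M1 ^ 3 / (Cμ / ρ * ρ)) * ρ ^ 4)
    (K2 := (1.5 * s ^ 12 * Real.exp (μ * s) * M1 * ρ / (Cμ / ρ)) * (4 * α) / 0.9) ?_
    (R_integrable h hρ hμ0 _ hu1 hc1 hz1) (R_integrable h hρ hμ0 _ hu2 hc2 hz2) iD1 iD2 zD1 zD2
    ?_ ?_ ?_ ?_
  · intro x
    rw [gradForm_split A (hud x)]
    have n1 := h.nonneg x (gradient (fun y => (u y).re) x)
    have n2 := h.nonneg x (gradient (fun y => (u y).im) x)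
    have := hw x (1 - 2 * α)
    have := hw x (-1 - 2 * α)
    have n3 := add_nonneg n1 n2
    simp only [h𝒜] at n3
    positivity
  · intro x; exact mul_nonneg (hw x _) (sq_nonneg _)
  · intro x; exact mul_nonneg (hw x _) (sq_nonneg _)
  · have e : Cμ / ρ * ρ = Cμ := by field_simp
    rw [e]
    gcongr ?_ / Cμ * ρ ^ 4
    have hE1 : 1 ≤ Real.exp (μ * s) := by linarith
    have hq : 1 ≤ 3 * μ ^ 2 + (9 * ρ * θL + 3) * μ + 1 := by
      have : 0 ≤ 3 * μ ^ 2 + (9 * ρ * θL + 3) * μ := by positivity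
      linarith
    have hdd : (1:ℝ) ≤ (d:ℝ) ^ 2 := one_le_pow₀ hd1
    have l1 : s ^ 12 ≤ s ^ 16 := pow_le_pow_right₀ hs (by norm_num)
    have l2 : Real.exp (μ * s) ^ 3 ≤ Real.exp (μ * s) ^ 4 := pow_le_pow_right₀ hE1 (by norm_num)
    have l3 : M1 ^ 3 ≤ M1 ^ 4 := pow_le_pow_right₀ hM1 (by norm_num)
    calc 2 * s ^ 12 * Real.exp (μ * s) ^ 3 * M1 ^ 3
        = 2 * 1 * s ^ 12 * Real.exp (μ * s) ^ 3 * M1 ^ 3 * 1 := by ring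
      _ ≤ _ := by gcongr
  · filter_upwards [hae] with x hx
    have k1 := hkey _ hu1 (ht1.trans hus) x hx
    have k2 := hkey _ hu2 (ht2.trans hus) x hx
    rw [gradForm_split A (hud x)]
    have hn : ‖u x‖ ^ 2 = (u x).re ^ 2 + (u x).im ^ 2 := by
      rw [Complex.sq_norm, Complex.normSq_apply]; ring
    rw [hn]
    simp only [h𝒜] at k1 k2 ⊢
    refine le_trans (le_of_eq ?_) ((add_le_add k1 k2).trans (le_of_eq ?_)) <;> ring
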